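/- arXiv:1108.4292 — 4 statements merged into one kernel-verified Lean document; each statement's English description precedes it below -/
import Mathlib

section
/- Let X be a nonempty σ-compact metric space. Then dim_tH X = min{d : there exists A ⊆ X with dim_H A ≤ d−1 and X \ A totally disconnected}. -/
open TopologicalSpace Set ENNReal NNReal MeasureTheory

/-- The topological Hausdorff dimension of a metric space: the infimum of all `d ∈ [0,∞]`
such that the space has a topological basis all of whose members `U` satisfy
`dimH (frontier U) ≤ d - 1` (with the convention `dimH ∅ = -1`, i.e. for `d < 1` the
condition forces `frontier U = ∅`). -/
noncomputable def dimTH (X : Type*) [EMetricSpace X] : ℝ≥0∞ :=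
  ⨅ (d : ℝ≥0∞) (_ : ∃ B : Set (Set X), IsTopologicalBasis B ∧
      ∀ U ∈ B, frontier U = ∅ ∨ dimH (frontier U) + 1 ≤ d), d

open Filter Topology Metric

/-- Enlarge a set to an open set with controlled diameter. -/
lemma aux_open_enlarge {X : Type*} [MetricSpace X] (t : Set X) (d : ℝ) (hd : 0 < d)
    (δ : ℝ≥0∞) (hδ : 0 < δ) :
    ∃ U : Set X, IsOpen U ∧ t ⊆ U ∧ ediam U ≤ ediam t + δ ∧ ediam U ^ d ≤ ediam t ^ d + δ := by
  by_cases htop : ediam t = ∞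
  · refine ⟨univ, isOpen_univ, subset_univ _, ?_, ?_⟩
    · simp [htop]
    · simp [htop, ENNReal.top_rpow_of_pos hd]
  have hc : Continuous fun ε : ℝ≥0 => ediam t + 2 * (ε : ℝ≥0∞) :=
    continuous_const.add ((ENNReal.continuous_const_mul (by simp)).comp ENNReal.continuous_coe)
  have hc2 : Continuous fun ε : ℝ≥0 => (ediam t + 2 * (ε : ℝ≥0∞)) ^ d :=
    (ENNReal.continuous_rpow_const).comp hc
  have h1 : ∀ᶠ ε : ℝ≥0 in 𝓝[>] (0 : ℝ≥0), ediam t + 2 * (ε : ℝ≥0∞) < ediam t + δ := by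
    refine nhdsWithin_le_nhds ((hc.tendsto 0).eventually_lt_const ?_)
    simpa using ENNReal.lt_add_right htop hδ.ne'
  have h2 : ∀ᶠ ε : ℝ≥0 in 𝓝[>] (0 : ℝ≥0), (ediam t + 2 * (ε : ℝ≥0∞)) ^ d < ediam t ^ d + δ := by
    refine nhdsWithin_le_nhds ((hc2.tendsto 0).eventually_lt_const ?_)
    simpa using ENNReal.lt_add_right (ENNReal.rpow_ne_top_of_nonneg hd.le htop) hδ.ne'
  obtain ⟨ε, ⟨h1, h2⟩, h3⟩ := ((h1.and h2).and self_mem_nhdsWithin).exists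
  have h3 : 0 < ε := h3
  refine ⟨thickening ε t, isOpen_thickening, self_subset_thickening (by exact_mod_cast h3) t, ?_, ?_⟩
  · exact (ediam_thickening_le ε).trans h1.le
  · exact (ENNReal.rpow_le_rpow (ediam_thickening_le ε) hd.le).trans h2.le

open scoped MeasureTheory in
lemma aux_cover {X : Type*} [MetricSpace X] [MeasurableSpace X] [BorelSpace X] (A : Set X) (d : ℝ)
    (hd : 0 < d) (hA : μH[d] A = 0) (ε : ℝ≥0∞) (hε : 0 < ε) :
    ∃ U : ℕ → Set X, (∀ i, IsOpen (U i)) ∧ A ⊆ ⋃ i, U i ∧ (∀ i, ediam (U i) ≤ ε + ε) ∧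
      ∑' i, ediam (U i) ^ d ≤ ε + ε := by
  rw [Measure.hausdorffMeasure_apply] at hA
  simp only [ENNReal.iSup_eq_zero] at hA
  have h := hA ε hε
  have h' := h.trans_lt hε
  simp only [iInf_lt_iff] at h'
  obtain ⟨t, hAt, htd, hts⟩ := h'
  obtain ⟨δ, hδ, hδs⟩ := ENNReal.exists_pos_sum_of_countable' hε.ne' ℕ
  have hδε : ∀ i, δ i ≤ ε := fun i => (ENNReal.le_tsum i).trans hδs.le
  choose U hUo hUt hU1 hU2 using fun i => aux_open_enlarge (t i) d hd (δ i) (hδ i)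
  refine ⟨U, hUo, hAt.trans (iUnion_mono hUt), fun i => (hU1 i).trans (add_le_add (htd i) (hδε i)), ?_⟩
  calc ∑' i, ediam (U i) ^ d ≤ ∑' i, (ediam (t i) ^ d + δ i) := ENNReal.tsum_le_tsum hU2
    _ = ∑' i, ediam (t i) ^ d + ∑' i, δ i := ENNReal.tsum_add
    _ ≤ ε + ε := by
      refine add_le_add (le_trans (ENNReal.tsum_le_tsum fun i => ?_) hts.le) hδs.le
      rcases (t i).eq_empty_or_nonempty with h0 | h0
      · simp [h0, ENNReal.zero_rpow_of_pos hd]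
      · simp [h0]

lemma aux_null_hull {X : Type*} [MetricSpace X] [MeasurableSpace X] [BorelSpace X] (A : Set X)
    (d : ℝ) (hd : 0 < d) (hA : μH[d] A = 0) : ∃ G, IsGδ G ∧ A ⊆ G ∧ μH[d] G = 0 := by
  have hpos : ∀ n : ℕ, (0 : ℝ≥0∞) < (n : ℝ≥0∞)⁻¹ := fun n => by simp
  choose U hUo hAU hU1 hU2 using fun n : ℕ => aux_cover A d hd hA (n : ℝ≥0∞)⁻¹ (hpos n)
  have hlim : Tendsto (fun n : ℕ => (n : ℝ≥0∞)⁻¹ + (n : ℝ≥0∞)⁻¹) atTop (𝓝 0) := by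
    simpa using ENNReal.tendsto_inv_nat_nhds_zero.add ENNReal.tendsto_inv_nat_nhds_zero
  refine ⟨⋂ n, ⋃ i, U n i, IsGδ.iInter_of_isOpen fun n => isOpen_iUnion (hUo n),
    subset_iInter hAU, ?_⟩
  have h := Measure.hausdorffMeasure_le_liminf_tsum d (⋂ n, ⋃ i, U n i) (l := atTop) _ hlim U
    (Eventually.of_forall hU1) (Eventually.of_forall fun n => iInter_subset _ n)
  refine le_antisymm (h.trans ?_) bot_le
  refine (liminf_le_liminf (Eventually.of_forall hU2)).trans ?_
  rw [hlim.liminf_eq]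

lemma aux_hull {X : Type*} [MetricSpace X] (A : Set X) :
    ∃ G, IsGδ G ∧ A ⊆ G ∧ dimH G ≤ dimH A := by
  borelize X
  have key : ∀ q : ℚ, ∃ G, IsGδ G ∧ A ⊆ G ∧ (dimH A < ((Real.toNNReal q : ℝ≥0) : ℝ≥0∞) →
      dimH G ≤ ((Real.toNNReal q : ℝ≥0) : ℝ≥0∞)) := by
    intro q
    by_cases hq : dimH A < ((Real.toNNReal q : ℝ≥0) : ℝ≥0∞)
    · have hpos : (0 : ℝ) < ((Real.toNNReal q : ℝ≥0) : ℝ) := by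
        have h0 : (0 : ℝ≥0∞) < ((Real.toNNReal q : ℝ≥0) : ℝ≥0∞) := bot_le.trans_lt hq
        exact_mod_cast h0
      obtain ⟨G, hG, hAG, h0⟩ := aux_null_hull A _ hpos (hausdorffMeasure_of_dimH_lt hq)
      exact ⟨G, hG, hAG, fun _ => dimH_le_of_hausdorffMeasure_ne_top (by rw [h0]; exact zero_ne_top)⟩
    · exact ⟨univ, IsGδ.univ, subset_univ _, fun h => absurd h hq⟩
  choose G hG hAG hdim using key
  refine ⟨⋂ q, G q, IsGδ.iInter hG, subset_iInter hAG, ?_⟩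
  refine le_of_forall_gt_imp_ge_of_dense fun r hr => ?_
  obtain ⟨q, _, h1, h2⟩ := ENNReal.lt_iff_exists_rat_btwn.1 hr
  exact (dimH_mono (iInter_subset _ q)).trans ((hdim q h1).trans h2.le)

/-- One step of the separation argument. -/
lemma aux_step {X : Type*} [MetricSpace X] (K : Set X) (hK : IsCompact K)
    (hKd : IsTotallyDisconnected K) (C D : Set X) (hC : IsClosed C) (hD : IsClosed D)
    (hCD : Disjoint C D) : ∃ P Q : Set X, IsOpen P ∧ IsOpen Q ∧ C ⊆ P ∧ D ⊆ Q ∧ K ⊆ P ∪ Q ∧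
      Disjoint (closure P) (closure Q) := by
  have : CompactSpace K := isCompact_iff_compactSpace.1 hK
  have : TotallyDisconnectedSpace K := totallyDisconnectedSpace_subtype_iff.2 hKd
  obtain ⟨E, hE, hCE, hED⟩ := exists_clopen_of_closed_subset_open
    (Z := ((↑) : K → X) ⁻¹' C) (U := ((↑) : K → X) ⁻¹' Dᶜ)
    (hC.preimage continuous_subtype_val) (hD.isOpen_compl.preimage continuous_subtype_val)
    (preimage_mono hCD.subset_compl_right)
  have hE1 : IsClosed (((↑) : K → X) '' E) :=
    (hE.isClosed.isCompact.image continuous_subtype_val).isClosed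
  have hE2 : IsClosed (((↑) : K → X) '' Eᶜ) :=
    (hE.compl.isClosed.isCompact.image continuous_subtype_val).isClosed
  have hdisj : Disjoint (C ∪ ((↑) : K → X) '' E) (D ∪ ((↑) : K → X) '' Eᶜ) := by
    rw [Set.disjoint_left]
    rintro x (hx | ⟨y, hy, rfl⟩) (hx' | ⟨z, hz, hzy⟩)
    · exact Set.disjoint_left.1 hCD hx hx'
    · subst hzy; exact hz (hCE hx)
    · exact hED hy hx'
    · obtain rfl := Subtype.ext hzy; exact hz hy
  obtain ⟨P, hPo, hP, hPc⟩ := normal_exists_closure_subset (hC.union hE1)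
    (hD.union hE2).isOpen_compl hdisj.subset_compl_right
  obtain ⟨Q, hQo, hQ, hQc⟩ := normal_exists_closure_subset (hD.union hE2)
    (isClosed_closure (s := P)).isOpen_compl (subset_compl_comm.1 hPc)
  refine ⟨P, Q, hPo, hQo, subset_union_left.trans hP, subset_union_left.trans hQ, ?_,
    (Set.disjoint_left.2 fun x hx hx' => hQc hx' hx)⟩
  intro x hx
  by_cases h : (⟨x, hx⟩ : K) ∈ E
  · exact Or.inl (hP (Or.inr ⟨_, h, rfl⟩))
  · exact Or.inr (hQ (Or.inr ⟨_, h, rfl⟩))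

lemma aux_sep {X : Type*} [MetricSpace X] (K : ℕ → Set X) (hK : ∀ n, IsCompact (K n))
    (hKd : ∀ n, IsTotallyDisconnected (K n)) (C D : Set X) (hC : IsClosed C) (hD : IsClosed D)
    (hCD : Disjoint C D) : ∃ P : Set X, IsOpen P ∧ C ⊆ P ∧ P ⊆ Dᶜ ∧
      frontier P ⊆ (⋃ n, K n)ᶜ := by
  let S := {p : Set X × Set X // Disjoint (closure p.1) (closure p.2)}
  have step : ∀ (n : ℕ) (p : S), ∃ q : S, IsOpen q.1.1 ∧ IsOpen q.1.2 ∧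
      p.1.1 ⊆ q.1.1 ∧ p.1.2 ⊆ q.1.2 ∧ K n ⊆ q.1.1 ∪ q.1.2 := by
    rintro n ⟨⟨P, Q⟩, h⟩
    obtain ⟨P', Q', h1, h2, h3, h4, h5, h6⟩ := aux_step (K n) (hK n) (hKd n) _ _
      isClosed_closure isClosed_closure h
    exact ⟨⟨(P', Q'), h6⟩, h1, h2, subset_closure.trans h3, subset_closure.trans h4, h5⟩
  choose f hf1 hf2 hf3 hf4 hf5 using step
  let s : ℕ → S := fun n => Nat.rec ⟨(C, D), by simpa [hC.closure_eq, hD.closure_eq] using hCD⟩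
    (fun n p => f n p) n
  have hs : ∀ n, s (n + 1) = f n (s n) := fun n => rfl
  have m1 : Monotone fun n => (s n).1.1 := monotone_nat_of_le_succ fun n => hf3 n (s n)
  have m2 : Monotone fun n => (s n).1.2 := monotone_nat_of_le_succ fun n => hf4 n (s n)
  have hPo : IsOpen (⋃ n, (s (n + 1)).1.1) := isOpen_iUnion fun n => hf1 n (s n)
  have hQo : IsOpen (⋃ n, (s (n + 1)).1.2) := isOpen_iUnion fun n => hf2 n (s n)
  have hPQ : Disjoint (⋃ n, (s (n + 1)).1.1) (⋃ n, (s (n + 1)).1.2) := by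
    rw [Set.disjoint_left]
    intro x hx hx'
    obtain ⟨i, hi⟩ := mem_iUnion.1 hx
    obtain ⟨j, hj⟩ := mem_iUnion.1 hx'
    have h1 := m1 (le_max_left (i + 1) (j + 1)) hi
    have h2 := m2 (le_max_right (i + 1) (j + 1)) hj
    exact Set.disjoint_left.1 (s (max (i + 1) (j + 1))).2 (subset_closure h1) (subset_closure h2)
  have hCP : C ⊆ ⋃ n, (s (n + 1)).1.1 :=
    Subset.trans (m1 (Nat.zero_le 1)) (subset_iUnion (fun n => (s (n + 1)).1.1) 0)
  have hDQ : D ⊆ ⋃ n, (s (n + 1)).1.2 :=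
    Subset.trans (m2 (Nat.zero_le 1)) (subset_iUnion (fun n => (s (n + 1)).1.2) 0)
  refine ⟨⋃ n, (s (n + 1)).1.1, hPo, hCP, fun x hx hxD => Set.disjoint_left.1 hPQ hx (hDQ hxD), ?_⟩
  intro x hx hxK
  obtain ⟨n, hn⟩ := mem_iUnion.1 hxK
  rw [hPo.frontier_eq] at hx
  rcases hf5 n (s n) hn with h | h
  · exact hx.2 (mem_iUnion.2 ⟨n, h⟩)
  · exact Set.disjoint_left.1 (hPQ.closure_left hQo) hx.1 (mem_iUnion.2 ⟨n, h⟩)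

lemma aux_basis {X : Type*} [MetricSpace X] (K : ℕ → Set X) (hK : ∀ n, IsCompact (K n))
    (hKd : ∀ n, IsTotallyDisconnected (K n)) :
    IsTopologicalBasis {U : Set X | IsOpen U ∧ frontier U ⊆ (⋃ n, K n)ᶜ} := by
  refine isTopologicalBasis_of_isOpen_of_nhds (fun u hu => hu.1) fun x u hx hu => ?_
  obtain ⟨P, h1, h2, h3, h4⟩ := aux_sep K hK hKd {x} uᶜ isClosed_singleton hu.isClosed_compl
    (by simpa using hx)
  exact ⟨P, ⟨h1, h4⟩, h2 rfl, by simpa using h3⟩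

/-- Complement of a Gδ with totally disconnected complement. -/
lemma aux_sigma {X : Type*} [MetricSpace X] [SigmaCompactSpace X] (G : Set X) (hG : IsGδ G)
    (hd : IsTotallyDisconnected Gᶜ) : ∃ K : ℕ → Set X, (∀ n, IsCompact (K n)) ∧
      (∀ n, IsTotallyDisconnected (K n)) ∧ ⋃ n, K n = Gᶜ := by
  obtain ⟨f, hf, rfl⟩ := hG.eq_iInter_nat
  have hU : ⋃ n : ℕ, (compactCovering X n.unpair.1 ∩ (f n.unpair.2)ᶜ) = (⋂ n, f n)ᶜ := by
    ext x
    simp only [mem_iUnion, mem_inter_iff, mem_compl_iff, mem_iInter, not_forall]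
    constructor
    · rintro ⟨n, _, h⟩; exact ⟨_, h⟩
    · rintro ⟨m, hm⟩
      obtain ⟨k, hk⟩ := exists_mem_compactCovering x
      exact ⟨Nat.pair k m, by simpa using ⟨hk, hm⟩⟩
  refine ⟨_, fun n => (isCompact_compactCovering X _).inter_right (hf _).isClosed_compl, ?_, hU⟩
  intro n t ht
  exact hd t (ht.trans (hU ▸ subset_iUnion (fun n : ℕ =>
    (compactCovering X n.unpair.1 ∩ (f n.unpair.2)ᶜ)) n))

lemma aux_totdisc {X : Type*} [MetricSpace X] (B : Set (Set X)) (hB : IsTopologicalBasis B)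
    (A : Set X) (hA : ∀ U ∈ B, frontier U ⊆ A) : IsTotallyDisconnected Aᶜ := by
  intro t htA ht x hx y hy
  by_contra hxy
  obtain ⟨U, hU, hxU, hUy⟩ := hB.exists_subset_of_mem_open (a := x) (u := {y}ᶜ) hxy
    isOpen_compl_singleton
  have hUo := hB.isOpen hU
  have hyU : y ∉ U := fun h => hUy h rfl
  have hfr : ∀ z ∈ t, z ∉ frontier U := fun z hz h => htA hz (hA U hU h)
  rw [hUo.frontier_eq] at hfr
  obtain ⟨z, _, hz1, hz2⟩ := ht U (closure U)ᶜ hUo isClosed_closure.isOpen_compl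
    (fun z hz => by
      by_cases h : z ∈ U
      · exact Or.inl h
      · exact Or.inr fun h' => hfr z hz ⟨h', h⟩)
    ⟨x, hx, hxU⟩ ⟨y, hy, fun h => hfr y hy ⟨h, hyU⟩⟩
  exact hz2 (subset_closure hz1)

lemma aux_fwd {X : Type*} [MetricSpace X] [SigmaCompactSpace X] (d : ℝ≥0∞)
    (h : ∃ B : Set (Set X), IsTopologicalBasis B ∧
      ∀ U ∈ B, frontier U = ∅ ∨ dimH (frontier U) + 1 ≤ d) :
    ∃ A : Set X, (A = ∅ ∨ dimH A + 1 ≤ d) ∧ IsTotallyDisconnected Aᶜ := by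
  obtain ⟨B, hB, hBd⟩ := h
  have : SecondCountableTopology X := EMetric.secondCountable_of_sigmaCompact X
  obtain ⟨B', hB'B, hB'c, hB'⟩ := hB.exists_countable
  refine ⟨⋃ U ∈ B', frontier U, ?_, aux_totdisc B' hB' _ fun U hU => subset_biUnion_of_mem (u := fun U : Set X => frontier U) hU⟩
  by_cases hall : ∀ U ∈ B', frontier U = ∅
  · left; simpa using hall
  · right
    push Not at hall
    obtain ⟨V, hV, hVn⟩ := hall
    have hd1 : 1 ≤ d := by
      rcases hBd V (hB'B hV) with h | h
      · exact absurd h hVn.ne_empty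
      · exact le_add_self.trans h
    rw [dimH_bUnion hB'c]
    calc _ ≤ (d - 1) + 1 := by
          gcongr
          refine iSup₂_le fun U hU => ?_
          rcases hBd U (hB'B hU) with h | h
          · simp [h]
          · exact ENNReal.le_sub_of_add_le_right one_ne_top h
      _ = d := tsub_add_cancel_of_le hd1

lemma aux_bwd {X : Type*} [MetricSpace X] [SigmaCompactSpace X] (d : ℝ≥0∞)
    (h : ∃ A : Set X, (A = ∅ ∨ dimH A + 1 ≤ d) ∧ IsTotallyDisconnected Aᶜ) :
    ∃ G : Set X, IsGδ G ∧ (G = ∅ ∨ dimH G + 1 ≤ d) ∧ IsTotallyDisconnected Gᶜ := by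
  obtain ⟨A, hA | hA, hd⟩ := h
  · exact ⟨∅, IsGδ.empty, Or.inl rfl, hA ▸ hd⟩
  · obtain ⟨G, hG, hAG, hdim⟩ := aux_hull A
    exact ⟨G, hG, Or.inr (le_trans (by gcongr) hA), fun t ht =>
      hd t (ht.trans (compl_subset_compl.2 hAG))⟩

lemma aux_bwd' {X : Type*} [MetricSpace X] [SigmaCompactSpace X] (d : ℝ≥0∞)
    (h : ∃ A : Set X, (A = ∅ ∨ dimH A + 1 ≤ d) ∧ IsTotallyDisconnected Aᶜ) :
    ∃ B : Set (Set X), IsTopologicalBasis B ∧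
      ∀ U ∈ B, frontier U = ∅ ∨ dimH (frontier U) + 1 ≤ d := by
  obtain ⟨G, hG, hGd, hGt⟩ := aux_bwd d h
  obtain ⟨K, hK, hKd, hKU⟩ := aux_sigma G hG hGt
  refine ⟨_, aux_basis K hK hKd, ?_⟩
  rintro U ⟨_, hU⟩
  rw [hKU, compl_compl] at hU
  rcases hGd with h | h
  · left; exact subset_empty_iff.1 (h ▸ hU)
  · right; exact le_trans (add_le_add_left (dimH_mono hU) 1) h

lemma aux_min {X : Type*} [MetricSpace X] [SigmaCompactSpace X] :
    ∃ A : Set X, (A = ∅ ∨ dimH A + 1 ≤ sInf {d : ℝ≥0∞ | ∃ A : Set X,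
        (A = ∅ ∨ dimH A + 1 ≤ d) ∧ IsTotallyDisconnected Aᶜ}) ∧ IsTotallyDisconnected Aᶜ := by
  set S := {d : ℝ≥0∞ | ∃ A : Set X, (A = ∅ ∨ dimH A + 1 ≤ d) ∧ IsTotallyDisconnected Aᶜ} with hS
  have hne : S.Nonempty := ⟨∞, univ, Or.inr le_top, by rw [compl_univ]; exact isTotallyDisconnected_empty⟩
  obtain ⟨u, _, hu, huS⟩ := exists_seq_tendsto_sInf hne (OrderBot.bddBelow S)
  choose G hG hGd hGt using fun n => aux_bwd (u n) (huS n)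
  by_cases hemp : ∃ n, G n = ∅
  · obtain ⟨n, hn⟩ := hemp
    exact ⟨G n, Or.inl hn, hGt n⟩
  push Not at hemp
  choose K hK hKd hKU using fun n => aux_sigma (G n) (hG n) (hGt n)
  have hb := aux_basis (fun n : ℕ => K n.unpair.1 n.unpair.2) (fun n => hK _ _) (fun n => hKd _ _)
  have hU : (⋃ n : ℕ, K n.unpair.1 n.unpair.2)ᶜ = ⋂ n, G n := by
    rw [compl_eq_comm, compl_iInter, Set.iUnion_unpair]
    exact (iUnion_congr hKU).symm
  rw [hU] at hb
  refine ⟨⋂ n, G n, Or.inr ?_, aux_totdisc _ hb _ fun U hU => hU.2⟩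
  refine ge_of_tendsto' hu fun n => ?_
  rcases hGd n with h | h
  · exact absurd h (hemp n).ne_empty
  · exact le_trans (add_le_add_left (dimH_mono (iInter_subset _ n)) 1) h

/-- For a nonempty σ-compact metric space:
`dimTH X = min {d : ∃ A ⊆ X with dimH A ≤ d - 1 and X \ A totally disconnected}`. -/
theorem stmt10 (X : Type*) [MetricSpace X] [Nonempty X] [SigmaCompactSpace X] :
    (dimTH X = ⨅ (d : ℝ≥0∞) (_ : ∃ A : Set X,
        (A = ∅ ∨ dimH A + 1 ≤ d) ∧ IsTotallyDisconnected Aᶜ), d) ∧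
    ∃ A : Set X, (A = ∅ ∨ dimH A + 1 ≤ dimTH X) ∧ IsTotallyDisconnected Aᶜ := by
  have heq : dimTH X = ⨅ (d : ℝ≥0∞) (_ : ∃ A : Set X,
        (A = ∅ ∨ dimH A + 1 ≤ d) ∧ IsTotallyDisconnected Aᶜ), d := by
    unfold dimTH
    exact iInf_congr fun d => iInf_congr_Prop ⟨aux_fwd d, aux_bwd' d⟩ fun _ => rfl
  refine ⟨heq, ?_⟩
  have h := aux_min (X := X)
  rw [sInf_eq_iInf] at h
  rw [heq]
  exact h
end

section
/- Let X be a metric space and Y ⊆ X a separable subspace. Then there exists a Gδ set G ⊆ X with Y ⊆ G and dim_tH G = dim_tH Y (enlargement theorem for the topological Hausdorff dimension). -/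
open TopologicalSpace Set ENNReal NNReal MeasureTheory

open Filter Topology Metric

theorem exists_open_enlarge {X : Type*} [MetricSpace X] (t : Set X) (ht : ediam t ≠ ∞)
    {s : ℝ} (hs : 0 < s) {ε : ℝ≥0∞} (hε : ε ≠ 0) :
    ∃ T : Set X, IsOpen T ∧ t ⊆ T ∧ ediam T ≤ ediam t + ε ∧ ediam T ^ s ≤ ediam t ^ s + ε := by
  have hc : Continuous (fun δ : ℝ≥0 => ediam t + 2 * (δ : ℝ≥0∞)) :=
    continuous_const.add ((ENNReal.continuous_const_mul (by simp)).comp ENNReal.continuous_coe)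
  have hc2 : Continuous (fun δ : ℝ≥0 => (ediam t + 2 * (δ : ℝ≥0∞)) ^ s) :=
    ENNReal.continuous_rpow_const.comp hc
  have h1 : ∀ᶠ δ : ℝ≥0 in 𝓝 0, ediam t + 2 * (δ : ℝ≥0∞) < ediam t + ε := by
    refine hc.continuousAt.eventually_lt_const ?_
    simpa using ENNReal.lt_add_right ht hε
  have h2 : ∀ᶠ δ : ℝ≥0 in 𝓝 0, (ediam t + 2 * (δ : ℝ≥0∞)) ^ s < ediam t ^ s + ε := by
    refine hc2.continuousAt.eventually_lt_const ?_
    simpa using ENNReal.lt_add_right (ENNReal.rpow_ne_top_of_nonneg hs.le ht) hε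
  have h3 : ∀ᶠ δ : ℝ≥0 in 𝓝[>] 0, 0 < δ := eventually_mem_nhdsWithin
  obtain ⟨δ, h0, h1, h2⟩ :=
    (h3.and ((h1.and h2).filter_mono nhdsWithin_le_nhds)).exists
  have hd := Metric.ediam_thickening_le (s := t) δ
  refine ⟨thickening δ t, isOpen_thickening, self_subset_thickening (by exact_mod_cast h0) _,
    hd.trans h1.le, (ENNReal.rpow_le_rpow hd hs.le).trans h2.le⟩

theorem exists_gdelta_null {X : Type*} [MetricSpace X] [MeasurableSpace X] [BorelSpace X]
    (F : Set X) {s : ℝ} (hs : 0 < s) (h : μH[s] F = 0) :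
    ∃ H : Set X, IsGδ H ∧ F ⊆ H ∧ μH[s] H = 0 := by
  have key : ∀ n : ℕ, ∃ T : ℕ → Set X, (∀ i, IsOpen (T i)) ∧ F ⊆ ⋃ i, T i ∧
      (∀ i, ediam (T i) ≤ 2 * ((n : ℝ≥0∞) + 1)⁻¹) ∧
      ∑' i, ediam (T i) ^ s ≤ 2 * ((n : ℝ≥0∞) + 1)⁻¹ := by
    intro n
    set r : ℝ≥0∞ := ((n : ℝ≥0∞) + 1)⁻¹ with hr
    have hr0 : 0 < r := by simp [hr]
    have hrt : r ≠ ∞ := by simp [hr]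
    rw [Measure.hausdorffMeasure_apply] at h
    have h' : ⨅ (t : ℕ → Set X) (_ : F ⊆ ⋃ n, t n) (_ : ∀ n, ediam (t n) ≤ r),
          ∑' n, ⨆ _ : (t n).Nonempty, ediam (t n) ^ s < r := by
      refine lt_of_le_of_lt (le_trans ?_ h.le) hr0
      exact le_iSup₂_of_le r hr0 le_rfl
    simp only [iInf_lt_iff] at h'
    obtain ⟨t, htF, htd, hts⟩ := h'
    obtain ⟨e, he0, hes⟩ := ENNReal.exists_pos_sum_of_countable' hr0.ne' ℕ
    have : ∀ i, ∃ T : Set X, IsOpen T ∧ t i ⊆ T ∧ ediam T ≤ ediam (t i) + e i ∧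
        ediam T ^ s ≤ ediam (t i) ^ s + e i := fun i =>
      exists_open_enlarge (t i) (ne_top_of_le_ne_top hrt (htd i)) hs (he0 i).ne'
    choose T hT1 hT2 hT3 hT4 using this
    refine ⟨T, hT1, htF.trans (iUnion_mono hT2), fun i => ?_, ?_⟩
    · rw [two_mul]
      exact (hT3 i).trans (add_le_add (htd i) ((ENNReal.le_tsum i).trans hes.le))
    · have e1 : ∀ i, ediam (t i) ^ s ≤ ⨆ _ : (t i).Nonempty, ediam (t i) ^ s := by
        intro i
        rcases (t i).eq_empty_or_nonempty with h0 | h0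
        · simp [h0, ENNReal.zero_rpow_of_pos hs]
        · simp [h0]
      calc ∑' i, ediam (T i) ^ s ≤ ∑' i, ((⨆ _ : (t i).Nonempty, ediam (t i) ^ s) + e i) :=
            ENNReal.tsum_le_tsum fun i => (hT4 i).trans (add_le_add (e1 i) le_rfl)
        _ ≤ 2 * r := by
            rw [ENNReal.tsum_add, two_mul]
            exact add_le_add hts.le hes.le
  choose T hT1 hT2 hT3 hT4 using key
  refine ⟨⋂ n, ⋃ i, T n i, .iInter_of_isOpen fun n => isOpen_iUnion (hT1 n),
    subset_iInter hT2, ?_⟩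
  have lim : Tendsto (fun n : ℕ => 2 * ((n : ℝ≥0∞) + 1)⁻¹) atTop (𝓝 0) := by
    have h1 : Tendsto (fun n : ℕ => ((n : ℝ≥0∞) + 1)⁻¹) atTop (𝓝 0) := by
      have := (tendsto_add_atTop_iff_nat 1).2 ENNReal.tendsto_inv_nat_nhds_zero
      simpa using this
    simpa using ENNReal.Tendsto.const_mul h1 (Or.inr (by simp : (2 : ℝ≥0∞) ≠ ∞))
  have := Measure.hausdorffMeasure_le_liminf_tsum s (⋂ n, ⋃ i, T n i) _ lim T
    (.of_forall hT3) (.of_forall fun n => iInter_subset _ n)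
  refine le_antisymm (this.trans ?_) bot_le
  rw [← lim.liminf_eq]
  exact liminf_le_liminf (.of_forall hT4)

theorem exists_gdelta_hull {X : Type*} [MetricSpace X] (F : Set X) :
    ∃ H : Set X, IsGδ H ∧ F ⊆ H ∧ (F = ∅ → H = ∅) ∧ dimH H ≤ dimH F := by
  rcases F.eq_empty_or_nonempty with rfl | hne
  · exact ⟨∅, isOpen_empty.isGδ, Subset.rfl, fun _ => rfl, le_rfl⟩
  borelize X
  rcases eq_or_ne (dimH F) ∞ with ht | ht
  · exact ⟨univ, isOpen_univ.isGδ, subset_univ _, fun h => absurd h hne.ne_empty, by simp [ht]⟩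
  lift dimH F to ℝ≥0 using ht with D hD
  have : ∀ n : ℕ, ∃ H : Set X, IsGδ H ∧ F ⊆ H ∧ μH[((D + ((n : ℝ≥0) + 1)⁻¹ : ℝ≥0) : ℝ)] H = 0 := by
    intro n
    have hp : (0 : ℝ≥0) < ((n : ℝ≥0) + 1)⁻¹ := by positivity
    refine exists_gdelta_null F ?_ (hausdorffMeasure_of_dimH_lt ?_)
    · exact_mod_cast add_pos_of_nonneg_of_pos bot_le hp
    · rw [← hD]
      exact_mod_cast lt_add_of_pos_right D hp
  choose H h1 h2 h3 using this
  refine ⟨⋂ n, H n, .iInter h1, subset_iInter h2, fun h => absurd h hne.ne_empty, ?_⟩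
  have hle : ∀ n : ℕ, dimH (⋂ n, H n) ≤ ((D + ((n : ℝ≥0) + 1)⁻¹ : ℝ≥0) : ℝ≥0∞) := fun n =>
    (dimH_mono (iInter_subset H n)).trans
      (dimH_le_of_hausdorffMeasure_ne_top (by rw [h3 n]; simp))
  refine ge_of_tendsto' (?_ : Tendsto (fun n : ℕ => ((D + ((n : ℝ≥0) + 1)⁻¹ : ℝ≥0) : ℝ≥0∞))
    atTop (𝓝 _)) hle
  rw [ENNReal.tendsto_coe]
  have h1 : Tendsto (fun n : ℕ => ((n : ℝ≥0) + 1)⁻¹) atTop (𝓝 0) := by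
    have := (tendsto_add_atTop_iff_nat 1).2 (tendsto_inv_atTop_nhds_zero_nat (𝕜 := ℝ≥0))
    simpa using this
  simpa using h1.const_add D

theorem dimTH_mono {X : Type*} [MetricSpace X] {Y G : Set X} (h : Y ⊆ G) :
    dimTH ↥Y ≤ dimTH ↥G := by
  have hiso : Isometry (inclusion h) := fun _ _ => rfl
  refine le_iInf₂ fun d ⟨B, hB, hd⟩ => iInf₂_le d ⟨(fun U => inclusion h ⁻¹' U) '' B, ?_, ?_⟩
  · exact hB.isInducing hiso.isUniformInducing.isInducing
  · rintro _ ⟨U, hU, rfl⟩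
    have hf : frontier (inclusion h ⁻¹' U) ⊆ inclusion h ⁻¹' frontier U :=
      (continuous_inclusion h).frontier_preimage_subset U
    rcases hd U hU with h0 | h0
    · left
      rw [h0] at hf
      simpa using hf
    · right
      refine le_trans (add_le_add ?_ le_rfl) h0
      rw [← hiso.dimH_image]
      exact dimH_mono (image_subset_iff.2 hf)

theorem enlarge_aux {X : Type*} [MetricSpace X] (Y : Set X) [SeparableSpace ↥Y] (d : ℝ≥0∞)
    (hY : ∃ B : Set (Set ↥Y), IsTopologicalBasis B ∧
      ∀ U ∈ B, frontier U = ∅ ∨ dimH (frontier U) + 1 ≤ d) :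
    ∃ G : Set X, IsGδ G ∧ Y ⊆ G ∧ dimTH ↥G ≤ d := by
  have : SecondCountableTopology ↥Y := UniformSpace.secondCountable_of_separable _
  obtain ⟨B', hB', hd'⟩ := hY
  obtain ⟨B, hBB', hBc, hB⟩ := hB'.exists_countable
  have hd := fun U hU => hd' U (hBB' hU)
  have hind : IsInducing (Subtype.val : ↥Y → X) := IsInducing.subtypeVal
  choose H hH1 hH2 hH3 hH4 using
    fun U : Set ↥Y => exists_gdelta_hull (Subtype.val '' frontier U : Set X)
  let A : Set ↥Y → Set X := fun U => closure (Subtype.val '' U)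
  have hAc : ∀ U, IsClosed (A U) := fun U => isClosed_closure
  let W : ℕ → Set X := fun n =>
    ⋃ U ∈ {U ∈ B | ediam (A U) ≤ ((n : ℝ≥0∞) + 1)⁻¹}, (A Uᶜ)ᶜ
  have hA : ∀ U : Set ↥Y, ∀ y : ↥Y, (y : X) ∈ A U ↔ y ∈ closure U := by
    intro U y
    rw [hind.closure_eq_preimage_closure_image]; rfl
  have hcov : ∀ U : Set ↥Y, closure Y ⊆ A U ∪ A Uᶜ := by
    intro U
    rw [← closure_union, ← image_union, union_compl_self, image_univ, Subtype.range_coe]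
  let G : Set X := closure Y ∩ (⋂ U ∈ B, ((A U ∩ A Uᶜ)ᶜ ∪ H U)) ∩ ⋂ n, W n
  refine ⟨G, ?_, ?_, ?_⟩
  · refine (isClosed_closure.isGδ.inter (.biInter hBc fun U _ => ?_)).inter
      (.iInter_of_isOpen fun n => isOpen_biUnion fun U _ => (hAc _).isOpen_compl)
    exact ((hAc _).inter (hAc _)).isOpen_compl.isGδ.union (hH1 U)
  · intro y hy
    refine ⟨⟨subset_closure hy, mem_iInter₂.2 fun U hU => ?_⟩, mem_iInter.2 fun n => ?_⟩
    · by_cases hk : y ∈ A U ∩ A Uᶜ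
      · right
        apply hH2
        refine ⟨⟨y, hy⟩, ?_, rfl⟩
        rw [frontier_eq_closure_inter_closure]
        exact ⟨(hA U ⟨y, hy⟩).1 hk.1, (hA Uᶜ ⟨y, hy⟩).1 hk.2⟩
      · exact Or.inl hk
    · have hr : (0 : ℝ≥0∞) < ((n : ℝ≥0∞) + 1)⁻¹ / 2 := by
        simp [ENNReal.div_pos_iff]
      obtain ⟨U, hU, hyU, hUs⟩ := hB.exists_subset_of_mem_open
        (mem_eball_self hr : (⟨y, hy⟩ : ↥Y) ∈ eball _ _) isOpen_eball
      refine mem_iUnion₂.2 ⟨U, ⟨hU, ?_⟩, ?_⟩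
      · rw [Metric.ediam_closure, isometry_subtype_coe.ediam_image]
        refine (ediam_mono hUs).trans (ediam_eball_le.trans ?_)
        rw [ENNReal.mul_div_cancel (by simp) (by simp)]
      · intro hy'
        have := (hA Uᶜ ⟨y, hy⟩).1 hy'
        rw [(hB.isOpen hU).isClosed_compl.closure_eq] at this
        exact this hyU
  · refine iInf₂_le d ⟨(fun U => (Subtype.val ⁻¹' (A Uᶜ)ᶜ : Set ↥G)) '' B, ?_, ?_⟩
    · refine isTopologicalBasis_of_isOpen_of_nhds ?_ ?_
      · rintro _ ⟨U, hU, rfl⟩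
        exact (hAc _).isOpen_compl.preimage continuous_subtype_val
      · intro x O hx hO
        obtain ⟨ε, hε, hεO⟩ := EMetric.isOpen_iff.1 hO x hx
        obtain ⟨n, hn⟩ := ENNReal.exists_inv_nat_lt hε.ne'
        obtain ⟨U, ⟨hU, hUd⟩, hxU⟩ := mem_iUnion₂.1 (mem_iInter.1 x.2.2 n)
        refine ⟨_, ⟨U, hU, rfl⟩, hxU, fun z hz => hεO ?_⟩
        have hx' : (x : X) ∈ A U := (hcov U x.2.1.1).resolve_right hxU
        have hz' : (z : X) ∈ A U := (hcov U z.2.1.1).resolve_right hz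
        have : edist (z : X) x ≤ ediam (A U) := edist_le_ediam_of_mem hz' hx'
        refine lt_of_le_of_lt (this.trans (hUd.trans ?_)) hn
        exact ENNReal.inv_le_inv.2 le_self_add
    · rintro _ ⟨U, hU, rfl⟩
      have hsub : Subtype.val '' frontier (Subtype.val ⁻¹' (A Uᶜ)ᶜ : Set ↥G) ⊆ H U := by
        rintro _ ⟨z, hz, rfl⟩
        rw [frontier_eq_closure_inter_closure] at hz
        have h1 : (z : X) ∈ A U := by
          have hc : IsClosed (Subtype.val ⁻¹' A U : Set ↥G) :=
            (hAc U).preimage continuous_subtype_val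
          have hs : (Subtype.val ⁻¹' (A Uᶜ)ᶜ : Set ↥G) ⊆ Subtype.val ⁻¹' A U :=
            fun w hw => (hcov U w.2.1.1).resolve_right hw
          exact closure_minimal hs hc hz.1
        have h2 : (z : X) ∈ A Uᶜ := by
          have hc : IsClosed (Subtype.val ⁻¹' A Uᶜ : Set ↥G) :=
            (hAc _).preimage continuous_subtype_val
          refine closure_minimal (fun w hw => ?_) hc hz.2
          simpa using hw
        exact (mem_iInter₂.1 z.2.1.2 U hU).resolve_left fun h => h ⟨h1, h2⟩
      rcases hd U hU with h0 | h0
      · left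
        rw [hH3 U (by rw [h0, image_empty])] at hsub
        simpa using hsub
      · right
        refine le_trans (add_le_add ?_ le_rfl) h0
        rw [← isometry_subtype_coe.dimH_image,
          ← (isometry_subtype_coe (s := Y)).dimH_image (frontier U)]
        exact (dimH_mono hsub).trans (hH4 U)

/-- Enlargement theorem: every separable subspace is contained in a `Gδ` set of the same
topological Hausdorff dimension. -/
theorem stmt13 (X : Type*) [MetricSpace X] (Y : Set X) [SeparableSpace ↥Y] :
    ∃ G : Set X, IsGδ G ∧ Y ⊆ G ∧ dimTH ↥G = dimTH ↥Y := by
  set S : Set ℝ≥0∞ := {d | ∃ B : Set (Set ↥Y), IsTopologicalBasis B ∧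
      ∀ U ∈ B, frontier U = ∅ ∨ dimH (frontier U) + 1 ≤ d} with hS
  have hdS : dimTH ↥Y = sInf S := by rw [sInf_eq_iInf]; rfl
  have hne : S.Nonempty := ⟨∞, {U | IsOpen U}, isTopologicalBasis_opens, fun U _ => Or.inr le_top⟩
  obtain ⟨u, -, hu, huS⟩ := exists_seq_tendsto_sInf hne (OrderBot.bddBelow S)
  choose G h1 h2 h3 using fun n => enlarge_aux Y (u n) (huS n)
  refine ⟨⋂ n, G n, .iInter h1, subset_iInter h2, le_antisymm ?_ (dimTH_mono (subset_iInter h2))⟩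
  rw [hdS]
  exact ge_of_tendsto' hu fun n => (dimTH_mono (iInter_subset G n)).trans (h3 n)
end

section
/- Let X be a nonempty separable metric space. Then dim_H(X × [0,1]) = dim_H X + 1 and dim_tH(X × [0,1]) = dim_H X + 1, where the product carries the ℓ² product metric. -/
open TopologicalSpace Set ENNReal NNReal MeasureTheory

open Filter Metric
open scoped Topology

lemma cover_of_null {Y : Type*} [EMetricSpace Y] [MeasurableSpace Y] [BorelSpace Y] {d : ℝ}
    {S : Set Y} (h : μH[d] S = 0) {r ε : ℝ≥0∞} (hr : 0 < r) (hε : 0 < ε) :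
    ∃ t : ℕ → Set Y, S ⊆ ⋃ n, t n ∧ (∀ n, ediam (t n) ≤ r) ∧
      ∑' n, (⨆ _ : (t n).Nonempty, ediam (t n) ^ d) < ε := by
  rw [Measure.hausdorffMeasure_apply] at h
  simp only [ENNReal.iSup_eq_zero] at h
  have h2 := (h r hr).trans_lt hε
  simp only [iInf_lt_iff] at h2
  obtain ⟨t, h1, h2, h3⟩ := h2
  exact ⟨t, h1, h2, h3⟩

lemma slice_null {Y : Type*} [MetricSpace Y] [MeasurableSpace Y] [BorelSpace Y] {s : ℝ≥0}
    (f : Y → ℝ) (hf : LipschitzWith 1 f) (h : μH[(s : ℝ) + 1] (univ : Set Y) = 0) :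
    ∀ᵐ t : ℝ, μH[(s : ℝ)] (f ⁻¹' {t}) = 0 := by
  obtain ⟨ε, hε, hεs⟩ := ENNReal.exists_pos_sum_of_countable' (one_ne_zero (α := ℝ≥0∞)) ℕ
  have hr : ∀ n : ℕ, (0 : ℝ≥0∞) < (n : ℝ≥0∞)⁻¹ := fun n => by simp
  choose U hU1 hU2 hU3 using fun n => cover_of_null h (hr n) (hε n)
  set V : ℕ → ℕ → Set ℝ := fun n i => toMeasurable volume (f '' U n i) with hV
  set g : ℕ → ℕ → ℝ → ℝ≥0∞ := fun n i => (V n i).indicator (fun _ => ediam (U n i) ^ (s : ℝ))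
    with hg
  have hgm : ∀ n i, Measurable (g n i) := fun n i =>
    measurable_const.indicator (measurableSet_toMeasurable _ _)
  have hint : ∀ n i, ∫⁻ t, g n i t ≤ ⨆ _ : (U n i).Nonempty, ediam (U n i) ^ ((s : ℝ) + 1) := by
    intro n i
    rw [hg, lintegral_indicator (measurableSet_toMeasurable _ _), lintegral_const,
      Measure.restrict_apply_univ, measure_toMeasurable]
    rcases (U n i).eq_empty_or_nonempty with he | hne
    · simp [he]
    · rw [ciSup_pos hne, ENNReal.rpow_add_of_nonneg _ _ s.coe_nonneg zero_le_one, ENNReal.rpow_one]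
      gcongr
      refine (Real.volume_le_diam _).trans ?_
      simpa using hf.ediam_image_le (U n i)
  have htot : ∫⁻ t, ∑' n, ∑' i, g n i t ≠ ∞ := by
    rw [lintegral_tsum fun n => (Measurable.tsum (hgm n)).aemeasurable]
    refine ne_top_of_le_ne_top one_ne_top (le_trans ?_ hεs.le)
    refine ENNReal.tsum_le_tsum fun n => ?_
    rw [lintegral_tsum fun i => (hgm n i).aemeasurable]
    exact (ENNReal.tsum_le_tsum (hint n)).trans (hU3 n).le
  have hae := ae_lt_top (Measurable.tsum fun n => Measurable.tsum (hgm n)) htot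
  filter_upwards [hae] with t ht
  have hlim := ENNReal.tendsto_atTop_zero_of_tsum_ne_top ht.ne
  have key := Measure.hausdorffMeasure_le_liminf_tsum (ι := fun n => {i : ℕ // t ∈ V n i}) (s : ℝ)
    (f ⁻¹' {t}) (l := atTop) (fun n : ℕ => (n : ℝ≥0∞)⁻¹) ENNReal.tendsto_inv_nat_nhds_zero
    (fun n i => U n i.1) (Eventually.of_forall fun n i => hU2 n i.1)
    (Eventually.of_forall fun n y hy => by
      obtain ⟨i, hi⟩ := mem_iUnion.1 (hU1 n (mem_univ y))
      exact mem_iUnion.2 ⟨⟨i, subset_toMeasurable _ _ ⟨y, hi, hy⟩⟩, hi⟩)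
  have heq : ∀ n, ∑' i : {i : ℕ // t ∈ V n i}, ediam (U n i.1) ^ (s : ℝ) = ∑' i, g n i t := by
    intro n
    refine (tsum_subtype {i : ℕ | t ∈ V n i} (fun i => ediam (U n i) ^ (s : ℝ))).trans ?_
    rfl
  simp only [heq] at key
  rw [hlim.liminf_eq] at key
  exact le_antisymm key bot_le

lemma dimTH_lower (X : Type*) [MetricSpace X] [Nonempty X] [SeparableSpace X] 
    (B : Set (Set (X × ↥(Set.Icc (0 : ℝ) 1)))) (hB : IsTopologicalBasis B) (d : ℝ≥0∞)
    (h : ∀ U ∈ B, frontier U = ∅ ∨ dimH (frontier U) + 1 ≤ d) :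
    dimH (univ : Set X) + 1 ≤ d := by
  have : SecondCountableTopology X := UniformSpace.secondCountable_of_separable X
  obtain ⟨B', hB'sub, hB'c, hB'⟩ := hB.exists_countable
  set A := ⋃ U ∈ B', frontier U with hA
  have hmeet : ∀ x : X, ∃ U ∈ B', ∃ t, (x, t) ∈ frontier U := by
    intro x
    by_contra! hcon
    let i : ↥(Set.Icc (0 : ℝ) 1) → X × ↥(Set.Icc (0 : ℝ) 1) := fun t => (x, t)
    have hi : Continuous i := by fun_prop
    have hop : IsOpen ({i 1}ᶜ : Set (X × ↥(Set.Icc (0 : ℝ) 1))) := isOpen_compl_singleton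
    obtain ⟨U, hU, h0, hUs⟩ := hB'.exists_subset_of_mem_open (a := i 0) (by simp [i]) hop
    have hcl : IsClopen (i ⁻¹' U) := by
      rw [isClopen_iff_frontier_eq_empty, eq_empty_iff_forall_notMem]
      intro t ht
      exact hcon U hU t (hi.frontier_preimage_subset U ht)
    rcases isClopen_iff.1 hcl with h' | h'
    · have : (0 : ↥(Set.Icc (0 : ℝ) 1)) ∈ i ⁻¹' U := h0
      simp [h'] at this
    · have : (1 : ↥(Set.Icc (0 : ℝ) 1)) ∈ i ⁻¹' U := by simp [h']
      exact hUs this rfl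
  have h1 : 1 ≤ d := by
    obtain ⟨U, hU, t, ht⟩ := hmeet (Classical.arbitrary X)
    rcases h U (hB'sub hU) with h' | h'
    · simp [h'] at ht
    · exact le_add_self.trans h'
  have hproj : (univ : Set X) = Prod.fst '' A := by
    refine (eq_univ_of_forall fun x => ?_).symm
    obtain ⟨U, hU, t, ht⟩ := hmeet x
    exact ⟨(x, t), mem_biUnion hU ht, rfl⟩
  have h2 : dimH (univ : Set X) ≤ d - 1 := by
    rw [hproj]
    refine (LipschitzWith.prod_fst.dimH_image_le A).trans ?_
    rw [hA, dimH_bUnion hB'c]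
    refine iSup₂_le fun U hU => ?_
    rcases h U (hB'sub hU) with h' | h'
    · simp [h']
    · exact ENNReal.le_sub_of_add_le_right one_ne_top h'
  calc _ ≤ d - 1 + 1 := by gcongr
    _ = d := tsub_add_cancel_of_le h1


lemma slice_dim {Y : Type*} [MetricSpace Y] (e : ℝ≥0) (h : dimH (univ : Set Y) ≤ e + 1)
    (f : Y → ℝ) (hf : LipschitzWith 1 f) : ∀ᵐ t : ℝ, dimH (f ⁻¹' {t}) ≤ e := by
  borelize Y
  have hn : ∀ n : ℕ, ∀ᵐ t : ℝ, μH[((e + 1 / ((n : ℝ≥0) + 1) : ℝ≥0) : ℝ)] (f ⁻¹' {t}) = 0 := by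
    intro n
    refine slice_null f hf ?_
    have : dimH (univ : Set Y) < ((e + 1 / ((n : ℝ≥0) + 1) + 1 : ℝ≥0) : ℝ≥0∞) := by
      refine h.trans_lt ?_
      have : e + 1 < e + 1 / ((n : ℝ≥0) + 1) + 1 := by
        have : 0 < 1 / ((n : ℝ≥0) + 1) := by positivity
        gcongr
        exact lt_add_of_pos_right _ this
      exact_mod_cast this
    have := hausdorffMeasure_of_dimH_lt this
    simpa using this
  filter_upwards [ae_all_iff.2 hn] with t ht
  refine ENNReal.le_of_forall_pos_le_add fun ε hε _ => ?_
  obtain ⟨n, hn⟩ := exists_nat_one_div_lt hε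
  have h1 : dimH (f ⁻¹' {t}) ≤ ((e + 1 / ((n : ℝ≥0) + 1) : ℝ≥0) : ℝ≥0∞) :=
    dimH_le_of_hausdorffMeasure_ne_top (by rw [ht n]; simp)
  refine h1.trans ?_
  have : e + 1 / ((n : ℝ≥0) + 1) ≤ e + ε := by gcongr
  exact_mod_cast this

lemma exists_nnreal_add_one {D : ℝ≥0∞} (h1 : 1 ≤ D) (hD : D ≠ ∞) : ∃ e : ℝ≥0, D = e + 1 := by
  lift D to ℝ≥0 using hD
  refine ⟨D - 1, ?_⟩
  have : 1 ≤ D := by exact_mod_cast h1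
  have := tsub_add_cancel_of_le this
  exact_mod_cast this.symm

lemma dimTH_le (Y : Type*) [MetricSpace Y] (h1 : 1 ≤ dimH (univ : Set Y)) :
    dimTH Y ≤ dimH (univ : Set Y) := by
  by_cases hD : dimH (univ : Set Y) = ∞
  · simp [hD]
  obtain ⟨e, he⟩ := exists_nnreal_add_one h1 hD
  refine iInf₂_le _ ⟨{U | ∃ y : Y, ∃ r : ℝ, dimH (sphere y r) ≤ e ∧ U = ball y r}, ?_, ?_⟩
  · refine isTopologicalBasis_of_isOpen_of_nhds ?_ ?_
    · rintro _ ⟨y, r, -, rfl⟩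
      exact isOpen_ball
    · intro y u hy hu
      obtain ⟨ε, hε, hεu⟩ := Metric.isOpen_iff.1 hu y hy
      have hae := slice_dim e he.le (fun z => dist z y) (LipschitzWith.dist_left y)
      obtain ⟨r, hr, h0, hrε⟩ := (Measure.dense_of_ae hae).exists_between hε
      exact ⟨ball y r, ⟨y, r, hr, rfl⟩, mem_ball_self h0, (ball_subset_ball hrε.le).trans hεu⟩
  · rintro _ ⟨y, r, hr, rfl⟩
    right
    rw [he]
    gcongr
    exact (dimH_mono frontier_ball_subset_sphere).trans hr

lemma prod_lower (X : Type*) [MetricSpace X] [Nonempty X] :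
    dimH (univ : Set X) + 1 ≤ dimH (univ : Set (X × ↥(Set.Icc (0 : ℝ) 1))) := by
  by_cases hD : dimH (univ : Set (X × ↥(Set.Icc (0 : ℝ) 1))) = ∞
  · simp [hD]
  have h1 : 1 ≤ dimH (univ : Set (X × ↥(Set.Icc (0 : ℝ) 1))) := by
    have hI : dimH (Set.Icc (0 : ℝ) 1) = 1 := by
      rw [Real.dimH_of_nonempty_interior (by simp)]
      simp
    rw [← hI]
    have hl : LipschitzWith 1 (fun p : X × ↥(Set.Icc (0 : ℝ) 1) => (p.2 : ℝ)) :=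
      LipschitzWith.of_edist_le fun p q => le_max_right (edist p.1 q.1) (edist p.2 q.2)
    have := hl.dimH_range_le
    refine le_trans (dimH_mono ?_) this
    intro t ht
    exact ⟨(Classical.arbitrary X, ⟨t, ht⟩), rfl⟩
  obtain ⟨e, he⟩ := exists_nnreal_add_one h1 hD
  have hl : LipschitzWith 1 (fun p : X × ↥(Set.Icc (0 : ℝ) 1) => (p.2 : ℝ)) :=
      LipschitzWith.of_edist_le fun p q => le_max_right (edist p.1 q.1) (edist p.2 q.2)
  obtain ⟨t, ht, h0, ht1⟩ :=
    (Measure.dense_of_ae (slice_dim e he.le _ hl)).exists_between (zero_lt_one (α := ℝ))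
  rw [he]
  gcongr
  let i : X → X × ↥(Set.Icc (0 : ℝ) 1) := fun x => (x, ⟨t, h0.le, ht1.le⟩)
  have hi : Isometry i := fun x y => by simp [i, Prod.edist_eq]
  rw [← hi.dimH_image]
  refine le_trans (dimH_mono ?_) ht
  rintro _ ⟨x, -, rfl⟩
  rfl

lemma cover_pos {Y : Type*} [EMetricSpace Y] [MeasurableSpace Y] [BorelSpace Y] {s : ℝ}
    (hs : 0 < s) {S : Set Y} (h : μH[s] S = 0) {ε : ℝ≥0∞} (hε : 0 < ε) (hε' : ε ≠ ∞) :
    ∃ (t : ℕ → Set Y) (e : ℕ → ℝ≥0), S ⊆ ⋃ n, t n ∧ (∀ n, ediam (t n) ≤ e n) ∧ (∀ n, 0 < e n) ∧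
      ∑' n, (e n : ℝ≥0∞) ^ s ≤ ε := by
  have hε2 : 0 < ε / 2 := ENNReal.half_pos hε.ne'
  obtain ⟨t, h1, -, h3⟩ := cover_of_null h one_pos hε2
  obtain ⟨η, hη, hηs⟩ := ENNReal.exists_pos_sum_of_countable hε2.ne' ℕ
  set a : ℕ → ℝ≥0∞ := fun n => (⨆ _ : (t n).Nonempty, ediam (t n) ^ s) + η n with ha
  have hsum : ∑' n, a n ≤ ε := by
    rw [ha, ENNReal.tsum_add, ← ENNReal.add_halves ε]
    gcongr
  have hat : ∀ n, a n ≠ ∞ := fun n =>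
    ne_top_of_le_ne_top hε' ((ENNReal.le_tsum n).trans hsum)
  have hap : ∀ n, 0 < a n := fun n => by
    refine lt_of_lt_of_le ?_ le_add_self
    exact_mod_cast hη n
  have hbt : ∀ n, a n ^ (1 / s) ≠ ∞ := fun n =>
    ENNReal.rpow_ne_top_of_nonneg (by positivity) (hat n)
  refine ⟨t, fun n => (a n ^ (1 / s)).toNNReal, h1, fun n => ?_, fun n => ?_, ?_⟩
  · rw [ENNReal.coe_toNNReal (hbt n), one_div, ENNReal.le_rpow_inv_iff hs]
    rcases (t n).eq_empty_or_nonempty with he | hne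
    · simp [he, hs]
    · refine le_trans ?_ le_self_add
      rw [ciSup_pos hne]
  · exact ENNReal.toNNReal_pos (ENNReal.rpow_pos (hap n) (hat n)).ne' (hbt n)
  · refine le_trans (ENNReal.tsum_le_tsum fun n => ?_) hsum
    rw [ENNReal.coe_toNNReal (hbt n), ← ENNReal.rpow_mul, one_div_mul_cancel hs.ne',
      ENNReal.rpow_one]

lemma prod_null {X : Type*} [MetricSpace X] [MeasurableSpace X] [BorelSpace X]
    [MeasurableSpace (X × ↥(Set.Icc (0 : ℝ) 1))] [BorelSpace (X × ↥(Set.Icc (0 : ℝ) 1))]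
    {s : ℝ} (hs : 0 < s) (h : μH[s] (univ : Set X) = 0) :
    μH[s + 1] (univ : Set (X × ↥(Set.Icc (0 : ℝ) 1))) = 0 := by
  set δ : ℕ → ℝ≥0∞ := fun n => ((n : ℝ≥0∞) + 1)⁻¹ with hδ
  have hδ0 : Tendsto δ atTop (𝓝 0) := by
    have := (tendsto_add_atTop_iff_nat 1).2 ENNReal.tendsto_inv_nat_nhds_zero
    simpa [hδ] using this
  have hδp : ∀ n, 0 < δ n := fun n => by simp [hδ]
  have hδ1 : ∀ n, δ n ≤ 1 := fun n => by simp [hδ]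
  choose U e hU hd hp hsum using fun n =>
    cover_pos hs h (hδp n) (ne_top_of_le_ne_top one_ne_top (hδ1 n))
  set r : ℕ → ℝ≥0∞ := fun n => δ n ^ (1 / s) with hr
  have hr0 : Tendsto r atTop (𝓝 0) := by
    have := (ENNReal.continuous_rpow_const (y := 1 / s)).tendsto 0 |>.comp hδ0
    rwa [ENNReal.zero_rpow_of_pos (by positivity)] at this
  have her : ∀ n i, (e n i : ℝ≥0∞) ≤ r n := fun n i => by
    simp only [hr]
    rw [one_div, ENNReal.le_rpow_inv_iff hs]
    exact (ENNReal.le_tsum i).trans (hsum n)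
  have he1 : ∀ n i, e n i ≤ 1 := fun n i => by
    have : (e n i : ℝ≥0∞) ≤ 1 :=
      (her n i).trans (ENNReal.rpow_le_one (hδ1 n) (by positivity))
    exact_mod_cast this
  set N : ℕ → ℕ → ℕ := fun n i => ⌊1 / (e n i : ℝ)⌋₊ + 1 with hN
  have hNe : ∀ n i, (N n i : ℝ≥0) * e n i ≤ 2 := fun n i => by
    have h1 : ((⌊1 / (e n i : ℝ)⌋₊ : ℕ) : ℝ≥0) ≤ 1 / e n i := by
      have : ((⌊1 / (e n i : ℝ)⌋₊ : ℕ) : ℝ) ≤ 1 / (e n i : ℝ) := Nat.floor_le (by positivity)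
      exact_mod_cast this
    calc (N n i : ℝ≥0) * e n i = (⌊1 / (e n i : ℝ)⌋₊ : ℕ) * e n i + e n i := by
          simp only [hN]; push_cast; ring
      _ ≤ 1 / e n i * e n i + 1 := by gcongr; exact he1 n i
      _ = 2 := by rw [one_div_mul_cancel (hp n i).ne']; norm_num
  let T : ∀ n : ℕ, (Σ i : ℕ, Fin (N n i)) → Set (X × ↥(Set.Icc (0 : ℝ) 1)) := fun n p =>
    {q | q.1 ∈ U n p.1 ∧ (q.2 : ℝ) ∈ Set.Icc ((p.2 : ℕ) * (e n p.1 : ℝ))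
      (((p.2 : ℕ) + 1) * (e n p.1 : ℝ))}
  have hT : ∀ n p, ediam (T n p) ≤ e n p.1 := by
    rintro n ⟨i, k⟩
    refine Metric.ediam_le ?_
    rintro ⟨x, t⟩ ⟨hx, ht⟩ ⟨y, u⟩ ⟨hy, hu⟩
    rw [Prod.edist_eq]
    refine max_le ((Metric.edist_le_ediam_of_mem hx hy).trans (hd n i)) ?_
    rw [edist_nndist]
    have : dist (t : ℝ) (u : ℝ) ≤ e n i := by
      refine (Real.dist_le_of_mem_Icc ht hu).trans_eq ?_
      ring
    exact_mod_cast this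
  have key := Measure.hausdorffMeasure_le_liminf_tsum (s + 1)
    (univ : Set (X × ↥(Set.Icc (0 : ℝ) 1))) (l := atTop) r hr0 T
    (Eventually.of_forall fun n p => (hT n p).trans (her n p.1))
    (Eventually.of_forall fun n => by
      rintro ⟨x, t⟩ -
      obtain ⟨i, hi⟩ := mem_iUnion.1 (hU n (mem_univ x))
      have hpos : (0 : ℝ) < e n i := hp n i
      have ht0 : 0 ≤ (t : ℝ) / e n i := div_nonneg t.2.1 hpos.le
      have hk : ⌊(t : ℝ) / e n i⌋₊ < N n i := by
        rw [hN, Nat.lt_add_one_iff]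
        exact Nat.floor_le_floor (by gcongr; exact t.2.2)
      refine mem_iUnion.2 ⟨⟨i, ⟨_, hk⟩⟩, hi, ?_, ?_⟩
      · rw [← le_div_iff₀ hpos]
        exact Nat.floor_le ht0
      · rw [← div_le_iff₀ hpos]
        exact (Nat.lt_floor_add_one _).le)
  have hbound : ∀ n, ∑' p, ediam (T n p) ^ (s + 1) ≤ 2 * δ n := by
    intro n
    calc ∑' p, ediam (T n p) ^ (s + 1)
        ≤ ∑' p : (Σ i : ℕ, Fin (N n i)), (e n p.1 : ℝ≥0∞) ^ (s + 1) :=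
          ENNReal.tsum_le_tsum fun p => ENNReal.rpow_le_rpow (hT n p) (by positivity)
      _ = ∑' i, ∑' _ : Fin (N n i), (e n i : ℝ≥0∞) ^ (s + 1) := ENNReal.tsum_sigma' _
      _ ≤ ∑' i, 2 * (e n i : ℝ≥0∞) ^ s := by
          refine ENNReal.tsum_le_tsum fun i => ?_
          rw [tsum_fintype, Finset.sum_const, Finset.card_univ, Fintype.card_fin, nsmul_eq_mul,
            ENNReal.rpow_add_of_nonneg _ _ hs.le zero_le_one, ENNReal.rpow_one,
            mul_comm (_ ^ s), ← mul_assoc]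
          gcongr
          exact_mod_cast hNe n i
      _ ≤ 2 * δ n := by
          rw [ENNReal.tsum_mul_left]
          gcongr
          exact hsum n
  have hlim : Tendsto (fun n => 2 * δ n) atTop (𝓝 0) := by
    simpa using ENNReal.Tendsto.const_mul hδ0 (Or.inr (by simp : (2 : ℝ≥0∞) ≠ ∞))
  have hlim2 : Tendsto (fun n => ∑' p, ediam (T n p) ^ (s + 1)) atTop (𝓝 0) :=
    tendsto_of_tendsto_of_tendsto_of_le_of_le tendsto_const_nhds hlim (fun _ => bot_le) hbound
  rw [hlim2.liminf_eq] at key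
  exact le_antisymm key bot_le

lemma prod_upper (X : Type*) [MetricSpace X] :
    dimH (univ : Set (X × ↥(Set.Icc (0 : ℝ) 1))) ≤ dimH (univ : Set X) + 1 := by
  by_cases hD : dimH (univ : Set X) = ∞
  · simp [hD]
  let _ : MeasurableSpace X := borel X
  have _ : BorelSpace X := ⟨rfl⟩
  let _ : MeasurableSpace (X × ↥(Set.Icc (0 : ℝ) 1)) := borel _
  have _ : BorelSpace (X × ↥(Set.Icc (0 : ℝ) 1)) := ⟨rfl⟩
  lift dimH (univ : Set X) to ℝ≥0 using hD with D hDe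
  refine ENNReal.le_of_forall_pos_le_add fun ε hε _ => ?_
  have h0 : μH[((D + ε : ℝ≥0) : ℝ)] (univ : Set X) = 0 := by
    refine hausdorffMeasure_of_dimH_lt ?_
    rw [← hDe]
    exact_mod_cast lt_add_of_pos_right D hε
  have h1 := prod_null (lt_of_lt_of_le (NNReal.coe_pos.2 hε) (by simp)) h0
  have h2 : dimH (univ : Set (X × ↥(Set.Icc (0 : ℝ) 1))) ≤ ((D + ε + 1 : ℝ≥0) : ℝ≥0∞) := by
    refine dimH_le_of_hausdorffMeasure_ne_top ?_
    rw [NNReal.coe_add, NNReal.coe_one, h1]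
    simp
  refine h2.trans_eq ?_
  push_cast
  ring

/-- For a nonempty separable metric space `X`,
`dimTH (X × [0,1]) = dimH (X × [0,1]) = dimH X + 1`. -/
theorem stmt14 (X : Type*) [MetricSpace X] [Nonempty X] [SeparableSpace X] :
    dimH (Set.univ : Set (X × ↥(Set.Icc (0 : ℝ) 1))) = dimH (Set.univ : Set X) + 1 ∧
    dimTH (X × ↥(Set.Icc (0 : ℝ) 1)) = dimH (Set.univ : Set X) + 1 := by
  have h1 := le_antisymm (prod_upper X) (prod_lower X)
  refine ⟨h1, le_antisymm ?_ ?_⟩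
  · rw [← h1]
    refine dimTH_le _ ?_
    rw [h1]
    exact le_add_self
  · refine le_iInf₂ fun d hd => ?_
    obtain ⟨B, hB, h⟩ := hd
    exact dimTH_lower X B hB d h
end

section
/- For every (d,s,t) with d ∈ ℕ⁺ ∪ {∞}, s,t ∈ [1,∞], d ≤ s ≤ t, there exists a compact metric space K with dim_t K = d, dim_tH K = s and dim_H K = t; moreover the triples (−1,−1,−1) and (0,0,t) for t ∈ [0,∞] are also realized by compact metric spaces, and these are the only possible values of (dim_t, dim_tH, dim_H) for metric spaces. -/
open TopologicalSpace Set ENNReal NNReal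

/-- `indLe n X` means the small inductive (topological) dimension of `X` is at most `n`:
`X` has a basis whose boundaries have topological dimension at most `n - 1`
(empty boundaries for `n = 0`). -/
def indLe : ℕ → ∀ (X : Type) [TopologicalSpace X], Prop
  | 0, X, _ => ∃ B : Set (Set X), IsTopologicalBasis B ∧ ∀ U ∈ B, frontier U = ∅
  | n + 1, X, _ => ∃ B : Set (Set X), IsTopologicalBasis B ∧
      ∀ U ∈ B, indLe n ↥(frontier U)

/-- The small inductive topological dimension (for nonempty spaces), in `ℕ∞`. -/
noncomputable def dimt (X : Type) [TopologicalSpace X] : ℕ∞ :=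
  ⨅ (n : ℕ) (_ : indLe n X), (n : ℕ∞)

section Helpers
open MeasureTheory MeasureTheory.Measure Filter Topology

/-! ### Basic facts on the small inductive dimension -/

theorem indLe_of_isEmpty (n : ℕ) : ∀ (X : Type) [TopologicalSpace X] [IsEmpty X], indLe n X := by
  have hB : ∀ (X : Type) [TopologicalSpace X] [IsEmpty X], IsTopologicalBasis (∅ : Set (Set X)) := by
    intro X _ _
    refine isTopologicalBasis_of_isOpen_of_nhds (by simp) ?_
    intro a; exact isEmptyElim a
  cases n with
  | zero => intro X _ _; exact ⟨∅, hB X, by simp⟩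
  | succ n => intro X _ _; exact ⟨∅, hB X, by simp⟩

theorem indLe_succ (n : ℕ) : ∀ (X : Type) [TopologicalSpace X], indLe n X → indLe (n + 1) X := by
  induction n with
  | zero =>
    rintro X _ ⟨B, hB, h⟩
    refine ⟨B, hB, fun U hU => ?_⟩
    have : IsEmpty ↥(frontier U) := by rw [h U hU]; infer_instance
    exact indLe_of_isEmpty _ _
  | succ n ih =>
    rintro X _ ⟨B, hB, h⟩
    exact ⟨B, hB, fun U hU => ih _ (h U hU)⟩

theorem indLe_mono {n m : ℕ} (h : n ≤ m) (X : Type) [TopologicalSpace X] (hX : indLe n X) :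
    indLe m X := by
  induction h with
  | refl => exact hX
  | step _ ih => exact indLe_succ _ _ ih

theorem frontier_preimage_subset' {X Y : Type*} [TopologicalSpace X] [TopologicalSpace Y]
    {f : Y → X} (hf : Continuous f) (U : Set X) : frontier (f ⁻¹' U) ⊆ f ⁻¹' frontier U :=
  hf.frontier_preimage_subset U

theorem isTopologicalBasis_preimage {X Y : Type*} [TopologicalSpace X] [TopologicalSpace Y]
    {f : Y → X} (hf : IsInducing f) {B : Set (Set X)} (hB : IsTopologicalBasis B) :
    IsTopologicalBasis (preimage f '' B) := hB.isInducing hf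

theorem indLe_of_isInducing (n : ℕ) : ∀ (X Y : Type) [TopologicalSpace X] [TopologicalSpace Y]
    (f : Y → X), IsInducing f → indLe n X → indLe n Y := by
  induction n with
  | zero =>
    rintro X Y _ _ f hf ⟨B, hB, h⟩
    refine ⟨_, isTopologicalBasis_preimage hf hB, ?_⟩
    rintro _ ⟨U, hU, rfl⟩
    have := frontier_preimage_subset' hf.continuous U
    rw [h U hU] at this
    simpa using this
  | succ n ih =>
    rintro X Y _ _ f hf ⟨B, hB, h⟩
    refine ⟨_, isTopologicalBasis_preimage hf hB, ?_⟩
    rintro _ ⟨U, hU, rfl⟩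
    have hs : ∀ x ∈ frontier (f ⁻¹' U), f x ∈ frontier U :=
      frontier_preimage_subset' hf.continuous U
    refine ih _ _ (fun x : ↥(frontier (f ⁻¹' U)) => (⟨f x, hs x x.2⟩ : ↥(frontier U))) ?_ (h U hU)
    have h1 : IsInducing (fun x : ↥(frontier (f ⁻¹' U)) => f x) :=
      hf.comp IsInducing.subtypeVal
    exact IsInducing.of_comp (by exact Continuous.subtype_mk h1.continuous _)
      continuous_subtype_val h1

theorem dimt_le {X : Type} [TopologicalSpace X] {n : ℕ} (h : indLe n X) : dimt X ≤ n :=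
  iInf₂_le n h

theorem indLe_of_dimt_le {X : Type} [TopologicalSpace X] {n : ℕ} (h : dimt X ≤ n) : indLe n X := by
  by_contra hc
  have : ((n + 1 : ℕ) : ℕ∞) ≤ dimt X := by
    refine le_iInf₂ fun m hm => ?_
    by_contra hlt
    have : m ≤ n := by
      have := not_le.1 hlt
      norm_cast at this
      omega
    exact hc (indLe_mono this X hm)
  have := this.trans h
  norm_cast at this
  omega

/-! ### An Eilenberg type inequality -/

theorem exists_cover_of_hausdorff_zero {X : Type*} [EMetricSpace X] [MeasurableSpace X]
    [BorelSpace X] {p : ℝ} (h : μH[p] (univ : Set X) = 0) {r : ℝ≥0∞} (hr : 0 < r) {ε : ℝ≥0∞}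
    (hε : 0 < ε) : ∃ t : ℕ → Set X, univ ⊆ (⋃ n, t n) ∧ (∀ n, Metric.ediam (t n) ≤ r) ∧
      ∑' n, (⨆ _ : (t n).Nonempty, Metric.ediam (t n) ^ p) < ε := by
  rw [hausdorffMeasure_apply] at h
  have h1 := ENNReal.iSup_eq_zero.1 h r
  have h2 := ENNReal.iSup_eq_zero.1 h1 hr
  have h3 : (⨅ (t : ℕ → Set X) (_ : univ ⊆ ⋃ n, t n) (_ : ∀ n, Metric.ediam (t n) ≤ r),
          ∑' n, ⨆ _ : (t n).Nonempty, Metric.ediam (t n) ^ p) < ε := by rw [h2]; exact hε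
  simp only [iInf_lt_iff] at h3
  obtain ⟨t, a, b, c⟩ := h3
  exact ⟨t, a, b, c⟩

theorem ae_sphere_hausdorff_zero {X : Type*} [MetricSpace X] [MeasurableSpace X] [BorelSpace X]
    {q : ℝ} (hq : 0 ≤ q) (h : μH[q + 1] (univ : Set X) = 0) (x : X) :
    ∀ᵐ ρ : ℝ, μH[q] {y : X | dist y x = ρ} = 0 := by
  classical
  have hcov : ∀ k : ℕ, ∃ t : ℕ → Set X, univ ⊆ (⋃ n, t n) ∧
      (∀ n, Metric.ediam (t n) ≤ ((k : ℝ≥0∞) + 1)⁻¹) ∧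
      ∑' n, (⨆ _ : (t n).Nonempty, Metric.ediam (t n) ^ (q + 1)) < (2⁻¹ : ℝ≥0∞) ^ k := fun k =>
    exists_cover_of_hausdorff_zero h (by simp [ENNReal.add_eq_top])
      (ENNReal.pow_pos (by simp) k)
  choose t ht1 ht2 ht3 using hcov
  -- measurable shadows of the covering sets
  have hshadow : ∀ k n, ∃ J : Set ℝ, MeasurableSet J ∧ (∀ y ∈ t k n, dist y x ∈ J) ∧
      volume J * Metric.ediam (t k n) ^ q ≤
        2 * ⨆ _ : (t k n).Nonempty, Metric.ediam (t k n) ^ (q + 1) := by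
    intro k n
    rcases (t k n).eq_empty_or_nonempty with he | hne
    · refine ⟨∅, MeasurableSet.empty, by simp [he], by simp⟩
    · obtain ⟨y0, hy0⟩ := hne
      have hfin : Metric.ediam (t k n) ≠ ∞ :=
        ((ht2 k n).trans_lt (by simp [ENNReal.inv_lt_top])).ne
      refine ⟨Metric.closedBall (dist y0 x) (Metric.ediam (t k n)).toReal,
        Metric.isClosed_closedBall.measurableSet, ?_, ?_⟩
      · intro y hy
        rw [Metric.mem_closedBall, Real.dist_eq]
        have h1 := abs_dist_sub_le y y0 x
        have h2 : dist y y0 ≤ (Metric.ediam (t k n)).toReal := by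
          rw [dist_edist]
          exact ENNReal.toReal_mono hfin (Metric.edist_le_ediam_of_mem hy hy0)
        linarith
      · rw [Real.volume_closedBall, iSup_pos ⟨y0, hy0⟩, ENNReal.ofReal_mul (by norm_num),
          ENNReal.ofReal_toReal hfin, ENNReal.rpow_add_of_nonneg _ _ hq zero_le_one,
          ENNReal.rpow_one]
        simp only [ENNReal.ofReal_ofNat]
        rw [mul_assoc, mul_comm (Metric.ediam (t k n))]
  choose J hJm hJ hJv using hshadow
  let g : ℕ → ℝ → ℝ≥0∞ := fun k ρ => ∑' n, (J k n).indicator (fun _ => Metric.ediam (t k n) ^ q) ρ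
  have hgm : ∀ k, Measurable (g k) := fun k =>
    Measurable.tsum fun n => measurable_const.indicator (hJm k n)
  have hint : ∫⁻ ρ, ∑' k, g k ρ ≠ ∞ := by
    rw [lintegral_tsum fun k => (hgm k).aemeasurable]
    have : ∀ k, ∫⁻ ρ, g k ρ ≤ 2 * (2⁻¹ : ℝ≥0∞) ^ k := by
      intro k
      rw [lintegral_tsum fun n => (measurable_const.indicator (hJm k n)).aemeasurable]
      calc _ ≤ ∑' n, 2 * ⨆ _ : (t k n).Nonempty, Metric.ediam (t k n) ^ (q + 1) := by
            refine ENNReal.tsum_le_tsum fun n => ?_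
            rw [lintegral_indicator_const (hJm k n), mul_comm]
            exact hJv k n
        _ ≤ _ := by
            rw [ENNReal.tsum_mul_left]
            gcongr
            exact (ht3 k).le
    refine ne_top_of_le_ne_top ?_ (ENNReal.tsum_le_tsum this)
    rw [ENNReal.tsum_mul_left, ENNReal.tsum_geometric, ENNReal.one_sub_inv_two, inv_inv]
    exact ENNReal.mul_ne_top (by simp) (by simp)
  filter_upwards [ae_lt_top (Measurable.tsum hgm) hint] with ρ hρ
  have hlim : Tendsto (fun k => g k ρ) atTop (𝓝 0) :=
    ENNReal.tendsto_atTop_zero_of_tsum_ne_top hρ.ne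
  have key := hausdorffMeasure_le_liminf_tsum (β := ℕ)
    (ι := fun k => {n : ℕ // (t k n ∩ {y : X | dist y x = ρ}).Nonempty}) q
    {y : X | dist y x = ρ} (l := atTop) (fun k => ((k : ℝ≥0∞) + 1)⁻¹) (by
      have := (tendsto_add_atTop_iff_nat 1).2 ENNReal.tendsto_inv_nat_nhds_zero
      simpa using this)
    (fun k n => t k n ∩ {y : X | dist y x = ρ})
    (Eventually.of_forall fun k n => (Metric.ediam_mono inter_subset_left).trans (ht2 k n))
    (Eventually.of_forall fun k y hy => by
      obtain ⟨n, hn⟩ := mem_iUnion.1 (ht1 k (mem_univ y))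
      exact mem_iUnion.2 ⟨⟨n, ⟨y, hn, hy⟩⟩, hn, hy⟩)
  have hle : ∀ k, (∑' i : {n : ℕ // (t k n ∩ {y : X | dist y x = ρ}).Nonempty},
      Metric.ediam (t k i ∩ {y : X | dist y x = ρ}) ^ q) ≤ g k ρ := by
    intro k
    refine le_trans (ENNReal.tsum_le_tsum (g := fun i : {n : ℕ // (t k n ∩ {y : X | dist y x = ρ}).Nonempty} => (J k i).indicator
      (fun _ => Metric.ediam (t k i) ^ q) ρ) fun i => ?_) ?_
    · obtain ⟨n, y, hy, hyρ⟩ := i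
      have : ρ ∈ J k n := by
        have := hJ k n y hy
        rwa [show dist y x = ρ from hyρ] at this
      simp only [this, indicator_of_mem]
      exact ENNReal.rpow_le_rpow (Metric.ediam_mono inter_subset_left) hq
    · exact ENNReal.tsum_comp_le_tsum_of_injective Subtype.val_injective _
  have h0 : liminf (fun k => ∑' i : {n : ℕ // (t k n ∩ {y : X | dist y x = ρ}).Nonempty},
      Metric.ediam (t k i ∩ {y : X | dist y x = ρ}) ^ q) atTop = 0 :=
    (tendsto_of_tendsto_of_tendsto_of_le_of_le tendsto_const_nhds hlim
      (fun _ => zero_le) hle).liminf_eq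
  exact le_antisymm (key.trans h0.le) (zero_le)

/-- Balls with negligible boundaries form a basis. -/
theorem exists_basis_of_hausdorff_zero {X : Type*} [MetricSpace X] [MeasurableSpace X]
    [BorelSpace X] {q : ℝ} (hq : 0 ≤ q) (h : μH[q + 1] (univ : Set X) = 0) :
    ∃ B : Set (Set X), IsTopologicalBasis B ∧ ∀ U ∈ B, μH[q] (frontier U) = 0 := by
  refine ⟨{U | IsOpen U ∧ μH[q] (frontier U) = 0},
    isTopologicalBasis_of_isOpen_of_nhds (fun U hU => hU.1) ?_, fun U hU => hU.2⟩
  intro x U hxU hU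
  obtain ⟨ε, hε, hεU⟩ := Metric.isOpen_iff.1 hU x hxU
  have hae := ae_sphere_hausdorff_zero hq h x
  obtain ⟨ρ, hρ, hρ0⟩ : ∃ ρ ∈ Ioo 0 ε, μH[q] {y : X | dist y x = ρ} = 0 := by
    by_contra hcon
    push Not at hcon
    have : volume (Ioo 0 ε) = 0 := measure_mono_null (fun ρ hρ => hcon ρ hρ) hae
    simp at this
    linarith
  refine ⟨Metric.ball x ρ, ⟨Metric.isOpen_ball, measure_mono_null ?_ hρ0⟩,
    Metric.mem_ball_self hρ.1, (Metric.ball_subset_ball hρ.2.le).trans hεU⟩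
  exact Metric.frontier_ball_subset_sphere

theorem hausdorffMeasure_univ_coe {X : Type*} [MetricSpace X] [MeasurableSpace X]
    [BorelSpace X] {q : ℝ} (hq : 0 ≤ q) (s : Set X) :
    μH[q] (univ : Set s) = μH[q] s := by
  have := (isometry_subtype_coe (s := s)).hausdorffMeasure_image (d := q) (Or.inl hq) univ
  rw [← this]; simp

theorem indLe_of_hausdorff_zero (n : ℕ) : ∀ (X : Type) [MetricSpace X] [MeasurableSpace X]
    [BorelSpace X], μH[(n : ℝ) + 1] (univ : Set X) = 0 → indLe n X := by
  induction n with
  | zero =>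
    intro X _ _ _ h
    obtain ⟨B, hB, h2⟩ := exists_basis_of_hausdorff_zero (q := 0) le_rfl (by simpa using h)
    refine ⟨B, hB, fun U hU => ?_⟩
    by_contra hne
    have := one_le_hausdorffMeasure_zero_of_nonempty (nonempty_iff_ne_empty.2 hne)
    rw [h2 U hU] at this
    simp at this
  | succ n ih =>
    intro X _ _ _ h
    obtain ⟨B, hB, h2⟩ := exists_basis_of_hausdorff_zero (q := (n : ℝ) + 1) (by positivity)
      (by simpa using h)
    refine ⟨B, hB, fun U hU => ih _ ?_⟩
    rw [hausdorffMeasure_univ_coe (by positivity)]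
    exact h2 U hU

theorem indLe_of_dimH_lt {X : Type} [MetricSpace X] (n : ℕ)
    (h : dimH (univ : Set X) < (n : ℝ≥0∞) + 1) : indLe n X := by
  borelize X
  refine indLe_of_hausdorff_zero n X ?_
  have := hausdorffMeasure_of_dimH_lt (d := (n : ℝ≥0) + 1) (s := (univ : Set X)) (by simpa using h)
  simpa using this

theorem dimH_univ_coe {X : Type*} [MetricSpace X] (s : Set X) :
    dimH (univ : Set s) = dimH s := by
  have := (isometry_subtype_coe (s := s)).dimH_image univ
  rw [← this]; simp

theorem dimTH_le_s16 {X : Type*} [EMetricSpace X] {c : ℝ≥0∞} (B : Set (Set X))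
    (hB : IsTopologicalBasis B) (h : ∀ U ∈ B, frontier U = ∅ ∨ dimH (frontier U) + 1 ≤ c) :
    dimTH X ≤ c := iInf₂_le c ⟨B, hB, h⟩

theorem dimTH_eq_zero {X : Type} [MetricSpace X] (h : indLe 0 X) : dimTH X = 0 := by
  obtain ⟨B, hB, h⟩ := h
  exact le_antisymm (dimTH_le_s16 B hB fun U hU => Or.inl (h U hU)) (zero_le)

theorem indLe_zero_of_dimTH_lt {X : Type} [MetricSpace X] (h : dimTH X < 1) : indLe 0 X := by
  unfold dimTH at h
  simp only [iInf_lt_iff] at h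
  obtain ⟨c, ⟨B, hB, h2⟩, hc⟩ := h
  refine ⟨B, hB, fun U hU => (h2 U hU).resolve_right fun hh => ?_⟩
  exact absurd (hh.trans_lt hc) (by simp)

theorem dimTH_le_dimH {X : Type} [MetricSpace X] (h : 1 ≤ dimH (univ : Set X)) :
    dimTH X ≤ dimH (univ : Set X) := by
  borelize X
  refine le_of_forall_gt fun c hc => ?_
  obtain ⟨e, he1, he2⟩ := ENNReal.lt_iff_exists_nnreal_btwn.1 hc
  refine lt_of_le_of_lt ?_ he2
  have he : 1 ≤ e := by exact_mod_cast (h.trans he1.le)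
  have h0 := hausdorffMeasure_of_dimH_lt he1
  obtain ⟨B, hB, h2⟩ := exists_basis_of_hausdorff_zero (X := X) (q := ((e - 1 : ℝ≥0) : ℝ))
    (by positivity) (by rw [NNReal.coe_sub he]; simpa using h0)
  refine dimTH_le_s16 B hB fun U hU => Or.inr ?_
  have : dimH (frontier U) ≤ ((e - 1 : ℝ≥0) : ℝ≥0∞) :=
    dimH_le_of_hausdorffMeasure_ne_top (by rw [h2 U hU]; simp)
  calc dimH (frontier U) + 1 ≤ ((e - 1 : ℝ≥0) : ℝ≥0∞) + 1 := by gcongr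
    _ = e := by rw [← ENNReal.coe_one, ← ENNReal.coe_add, tsub_add_cancel_of_le he]

theorem indLe_of_dimTH_lt {X : Type} [MetricSpace X] (n : ℕ)
    (h : dimTH X < (n : ℝ≥0∞) + 1) : indLe n X := by
  cases n with
  | zero => exact indLe_zero_of_dimTH_lt (by simpa using h)
  | succ n =>
    unfold dimTH at h
    simp only [iInf_lt_iff] at h
    obtain ⟨c, ⟨B, hB, h2⟩, hc⟩ := h
    refine ⟨B, hB, fun U hU => ?_⟩
    rcases h2 U hU with h3 | h3
    · have : IsEmpty ↥(frontier U) := by rw [h3]; infer_instance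
      exact indLe_of_isEmpty _ _
    · refine indLe_of_dimH_lt n ?_
      rw [dimH_univ_coe]
      have := h3.trans_lt hc
      push_cast at this
      exact lt_of_add_lt_add_right this

theorem dimt_le_dimTH {X : Type} [MetricSpace X] : ((dimt X : ℕ∞) : ℝ≥0∞) ≤ dimTH X := by
  by_contra hlt
  push Not at hlt
  have hfin : dimTH X ≠ ∞ := (lt_of_lt_of_le hlt le_top).ne
  have hfl : dimTH X < (⌊(dimTH X).toReal⌋₊ : ℝ≥0∞) + 1 := by
    have := Nat.lt_floor_add_one (dimTH X).toReal
    rw [← ENNReal.ofReal_toReal hfin]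
    rw [ENNReal.toReal_ofReal ENNReal.toReal_nonneg]
    rw [ENNReal.ofReal_lt_iff_lt_toReal ENNReal.toReal_nonneg (by finiteness)]
    rw [ENNReal.toReal_add (by simp) (by simp)]
    simpa using this
  have h1 := dimt_le (indLe_of_dimTH_lt _ hfl)
  have h2 : ((dimt X : ℕ∞) : ℝ≥0∞) ≤ ((⌊(dimTH X).toReal⌋₊ : ℕ∞) : ℝ≥0∞) := by
    exact_mod_cast h1
  have h3 : ((⌊(dimTH X).toReal⌋₊ : ℕ∞) : ℝ≥0∞) ≤ dimTH X := by
    have := Nat.floor_le (a := (dimTH X).toReal) ENNReal.toReal_nonneg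
    rw [ENat.toENNReal_coe]
    rw [← ENNReal.toReal_le_toReal (by simp) hfin]
    simpa using this
  exact absurd (h2.trans h3) (not_le.2 hlt)

/-- Restrictions on the possible values of the dimensions. -/
theorem triple_restrictions {X : Type} [MetricSpace X] :
    (dimt X = 0 ∧ dimTH X = 0) ∨ (1 ≤ dimt X ∧ 1 ≤ dimTH X ∧ 1 ≤ dimH (univ : Set X) ∧
      ((dimt X : ℕ∞) : ℝ≥0∞) ≤ dimTH X ∧ dimTH X ≤ dimH (univ : Set X)) := by
  by_cases h0 : indLe 0 X
  · left
    exact ⟨le_antisymm (dimt_le h0) (zero_le), dimTH_eq_zero h0⟩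
  · right
    have hH : 1 ≤ dimH (univ : Set X) := by
      by_contra hc
      exact h0 (indLe_of_dimH_lt 0 (by simpa using hc))
    refine ⟨?_, ?_, hH, dimt_le_dimTH, dimTH_le_dimH hH⟩
    · rw [Order.one_le_iff_ne_zero]
      intro hc
      exact h0 (indLe_of_dimt_le (by simp [hc]))
    · by_contra hc
      exact h0 (indLe_zero_of_dimTH_lt (not_le.1 hc))


/-! ### A cubical version of Sperner's lemma -/

/-- Indicator of `a < j`. -/
def sInd (a j : ℕ) : ℕ := if a < j then 1 else 0

/-- Vertices of the Freudenthal simplex with base point `v` and rank permutation `τ`. -/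
def sVert {N : ℕ} (v : Fin N → ℕ) (τ : Equiv.Perm (Fin N)) (j : ℕ) : Fin N → ℕ :=
  fun i => v i + sInd (τ i) j

open Classical in
/-- Indicator of rainbow label sequences. -/
noncomputable def sRainbow (N : ℕ) (L : Fin (N + 1) → ℕ) : ZMod 2 :=
  if ∀ c ≤ N, ∃ j, L j = c then 1 else 0

open Classical in
/-- Indicator of doors. -/
noncomputable def sDoor (N : ℕ) (L : Fin (N + 1) → ℕ) (j : Fin (N + 1)) : ZMod 2 :=
  if ∀ c < N, ∃ j', j' ≠ j ∧ L j' = c then 1 else 0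

theorem sum_sDoor (N : ℕ) (L : Fin (N + 1) → ℕ) (hL : ∀ j, L j ≤ N) :
    ∑ j, sDoor N L j = sRainbow N L := by
  classical
  by_cases hA : ∃ j0, ∀ c < N, ∃ j', j' ≠ j0 ∧ L j' = c
  · obtain ⟨j0, h0⟩ := hA
    have hsub : Finset.range N ⊆ (Finset.univ.erase j0).image L := by
      intro c hc
      obtain ⟨j', h1, h2⟩ := h0 c (Finset.mem_range.1 hc)
      exact Finset.mem_image.2 ⟨j', by simp [h1], h2⟩
    have hcard : (Finset.univ.erase j0).card = N := by simp
    have himg : (Finset.univ.erase j0).image L = Finset.range N := by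
      refine (Finset.eq_of_subset_of_card_le hsub ?_).symm
      have := Finset.card_image_le (s := Finset.univ.erase j0) (f := L)
      simpa [hcard] using this
    have hinj : Set.InjOn L (Finset.univ.erase j0 : Finset (Fin (N + 1))) := by
      rw [← Finset.card_image_iff, himg, hcard]; simp
    have hlt : ∀ j, j ≠ j0 → L j < N := by
      intro j hj
      have : L j ∈ (Finset.univ.erase j0).image L := Finset.mem_image_of_mem L (by simp [hj])
      rw [himg] at this
      exact Finset.mem_range.1 this
    have hinj' : ∀ j j', j ≠ j0 → j' ≠ j0 → L j = L j' → j = j' := fun j j' h h' he =>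
      hinj (by simp [h]) (by simp [h']) he
    by_cases hc : L j0 < N
    · obtain ⟨j1, h1, h1L⟩ := h0 (L j0) hc
      have hsum : ∑ j, sDoor N L j = sDoor N L j0 + sDoor N L j1 := by
        rw [← Finset.sum_pair h1.symm]
        symm
        refine Finset.sum_subset (Finset.subset_univ _) ?_
        intro j _ hj
        simp only [Finset.mem_insert, Finset.mem_singleton, not_or] at hj
        refine if_neg fun hd => ?_
        obtain ⟨j', h2, h3⟩ := hd (L j) (hlt j hj.1)
        by_cases hj0 : j' = j0
        · subst hj0
          exact hj.2 (hinj' j j1 hj.1 h1 (by rw [h1L, h3]))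
        · exact h2 (hinj' j' j hj0 hj.1 h3)
      have hd0 : sDoor N L j0 = 1 := if_pos h0
      have hd1 : sDoor N L j1 = 1 := by
        refine if_pos fun c hcN => ?_
        obtain ⟨j', h2, h3⟩ := h0 c hcN
        by_cases hj1 : j' = j1
        · subst hj1
          exact ⟨j0, h1.symm, by rw [← h1L, h3]⟩
        · exact ⟨j', hj1, h3⟩
      have hR : sRainbow N L = 0 := by
        refine if_neg fun h => ?_
        obtain ⟨j, hj⟩ := h N le_rfl
        by_cases hj0 : j = j0
        · subst hj0; omega
        · have := hlt j hj0; omega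
      rw [hsum, hd0, hd1, hR]
      decide
    · have hsum : ∑ j, sDoor N L j = sDoor N L j0 := by
        refine Finset.sum_eq_single j0 ?_ (by simp)
        intro j _ hj
        refine if_neg fun hd => ?_
        have hl := hlt j hj
        obtain ⟨j', h2, h3⟩ := hd (L j) hl
        have : j' ≠ j0 := by rintro rfl; omega
        exact h2 (hinj' j' j this hj h3)
      rw [hsum]
      by_cases hN : L j0 = N
      · rw [sDoor, if_pos h0, sRainbow, if_pos]
        intro c hcN
        rcases hcN.lt_or_eq with h | h
        · obtain ⟨j', _, h3⟩ := h0 c h; exact ⟨j', h3⟩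
        · exact ⟨j0, by omega⟩
      · exact absurd (hL j0) (by omega)
  · push Not at hA
    have hR : sRainbow N L = 0 := by
      refine if_neg fun h => ?_
      obtain ⟨j, hj⟩ := h N le_rfl
      obtain ⟨c, hc, hc2⟩ := hA j
      obtain ⟨j', hj'⟩ := h c hc.le
      exact hc2 j' (by rintro rfl; omega) hj'
    rw [hR]
    refine Finset.sum_eq_zero fun j _ => if_neg ?_
    push Not
    exact hA j


open Classical in
/-- Indicator of a door in the last facet, for an arbitrary base point. -/
noncomputable def sLast {M : ℕ} (l : (Fin (M + 1) → ℕ) → ℕ) (w : Fin (M + 1) → ℕ)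
    (τ : Equiv.Perm (Fin (M + 1))) : ZMod 2 :=
  if ∀ c < M + 1, ∃ j < M + 1, l (sVert w τ j) = c then 1 else 0

theorem sDoor_last {M : ℕ} (l : (Fin (M + 1) → ℕ) → ℕ) (v : Fin (M + 1) → ℕ)
    (τ : Equiv.Perm (Fin (M + 1))) :
    sDoor (M + 1) (fun j => l (sVert v τ j)) (Fin.last (M + 1)) = sLast l v τ := by
  unfold sDoor sLast
  congr 1
  apply propext
  refine forall₂_congr fun c _ => ⟨?_, ?_⟩
  · rintro ⟨j', h1, h2⟩
    exact ⟨j', Fin.val_lt_last h1, h2⟩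
  · rintro ⟨j, h1, h2⟩
    refine ⟨⟨j, by omega⟩, ?_, h2⟩
    intro h
    have := congrArg Fin.val h
    simp at this
    omega

theorem sVert_rotate {M : ℕ} (v : Fin (M + 1) → ℕ) (τ : Equiv.Perm (Fin (M + 1))) (j : ℕ)
    (hj : j < M + 1) :
    sVert v (finRotate (M + 1) * τ) (j + 1) =
      sVert (v + Pi.single (τ.symm (Fin.last M)) 1) τ j := by
  funext i
  simp only [sVert, Equiv.Perm.mul_apply, Pi.add_apply]
  by_cases hi : τ i = Fin.last M
  · have : i = τ.symm (Fin.last M) := by rw [← hi]; simp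
    rw [hi, finRotate_last, ← this]
    simp [sInd]
    omega
  · have : i ≠ τ.symm (Fin.last M) := by
      rintro rfl; simp at hi
    rw [Pi.single_eq_of_ne this, coe_finRotate_of_ne_last hi]
    simp [sInd]

theorem sDoor_zero {M : ℕ} (l : (Fin (M + 1) → ℕ) → ℕ) (v : Fin (M + 1) → ℕ)
    (τ : Equiv.Perm (Fin (M + 1))) :
    sDoor (M + 1) (fun j => l (sVert v (finRotate (M + 1) * τ) j)) 0 =
      sLast l (v + Pi.single (τ.symm (Fin.last M)) 1) τ := by
  unfold sDoor sLast
  congr 1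
  apply propext
  refine forall₂_congr fun c _ => ⟨?_, ?_⟩
  · rintro ⟨j', h1, h2⟩
    obtain ⟨j, rfl⟩ := Fin.exists_succ_eq.2 h1
    refine ⟨j, j.2, ?_⟩
    rw [← sVert_rotate v τ j j.2, ← h2]
    simp
  · rintro ⟨j, h1, h2⟩
    refine ⟨Fin.succ ⟨j, h1⟩, Fin.succ_ne_zero _, ?_⟩
    rw [← sVert_rotate v τ j h1] at h2
    simpa using h2

theorem sDoor_middle {M : ℕ} (L : (Fin (M + 1) → ℕ) → ℕ) (v : Fin (M + 1) → ℕ)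
    (a : Fin M) :
    ∑ τ : Equiv.Perm (Fin (M + 1)),
      sDoor (M + 1) (fun j => L (sVert v τ j)) (a.castSucc.succ) = 0 := by
  have hkey : ∀ (τ : Equiv.Perm (Fin (M + 1))) (j : Fin (M + 2)), j ≠ a.castSucc.succ →
      sVert v (Equiv.swap a.castSucc a.succ * τ) j = sVert v τ j := by
    intro τ j hj
    have hj' : (j : ℕ) ≠ a + 1 := fun h => hj (Fin.ext (by simpa using h))
    funext i
    simp only [sVert, Equiv.Perm.mul_apply]
    congr 1
    rw [Equiv.swap_apply_def]
    by_cases h1 : τ i = a.castSucc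
    · simp only [h1, if_true, Fin.val_succ, Fin.val_castSucc, sInd]
      congr 1
      apply propext
      omega
    · by_cases h2 : τ i = a.succ
      · have h3 : a.succ ≠ a.castSucc := by rw [← h2]; exact h1
        simp only [h2, h3, if_true, if_false, Fin.val_succ, Fin.val_castSucc, sInd]
        congr 1
        apply propext
        omega
      · simp [h1, h2]
  refine Finset.sum_involution (fun τ _ => Equiv.swap a.castSucc a.succ * τ) ?_ ?_ ?_ ?_
  · intro τ _
    have : sDoor (M + 1) (fun j => L (sVert v (Equiv.swap a.castSucc a.succ * τ) j))
        a.castSucc.succ = sDoor (M + 1) (fun j => L (sVert v τ j)) a.castSucc.succ := by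
      unfold sDoor
      congr 1
      apply propext
      refine forall₂_congr fun c _ => exists_congr fun j => and_congr_right fun hj => ?_
      simp only [hkey τ j hj]
    rw [this]
    exact CharTwo.add_self_eq_zero _
  · intro τ _ _ h
    have h2 : Equiv.swap a.castSucc a.succ = 1 := mul_eq_right.1 h
    rw [Equiv.swap_eq_one_iff] at h2
    have := congrArg Fin.val h2
    simp at this
  · simp
  · intro τ _
    simp [← mul_assoc]

/-- Extend a permutation by fixing the last element. -/
def extPerm {M : ℕ} (σ : Equiv.Perm (Fin M)) : Equiv.Perm (Fin (M + 1)) :=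
  finSuccEquivLast.symm.permCongr (Equiv.optionCongr σ)

theorem extPerm_castSucc {M : ℕ} (σ : Equiv.Perm (Fin M)) (i : Fin M) :
    extPerm σ i.castSucc = (σ i).castSucc := by
  simp [extPerm]

theorem extPerm_last {M : ℕ} (σ : Equiv.Perm (Fin M)) :
    extPerm σ (Fin.last M) = Fin.last M := by
  simp [extPerm]

theorem sum_perm_last {M : ℕ} (f : Equiv.Perm (Fin (M + 1)) → ZMod 2)
    (hf : ∀ τ : Equiv.Perm (Fin (M + 1)), τ (Fin.last M) ≠ Fin.last M → f τ = 0) :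
    ∑ τ, f τ = ∑ σ : Equiv.Perm (Fin M), f (extPerm σ) := by
  classical
  have hinj : Function.Injective (extPerm (M := M)) := by
    intro σ σ' h
    ext i
    have := congrArg (fun τ => ((τ i.castSucc : Fin (M + 1)) : ℕ)) h
    simpa [extPerm_castSucc] using this
  rw [← Finset.sum_image (s := Finset.univ) (g := extPerm) (f := f) hinj.injOn]
  symm
  refine Finset.sum_subset (Finset.subset_univ _) ?_
  intro τ _ hτ
  refine hf τ fun h => hτ ?_
  refine Finset.mem_image.2 ⟨Equiv.removeNone (finSuccEquivLast.permCongr τ), Finset.mem_univ _, ?_⟩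
  unfold extPerm
  have : Equiv.optionCongr (Equiv.removeNone (finSuccEquivLast.permCongr τ)) =
      finSuccEquivLast.permCongr τ := by
    have hn : (finSuccEquivLast.permCongr τ) none = none := by simp [Equiv.permCongr_apply, h]
    ext1 x
    cases x with
    | none => rw [hn]; simp
    | some a =>
      rw [Equiv.optionCongr_apply, Option.map_some]
      refine Equiv.removeNone_some _ ?_
      rw [← Option.ne_none_iff_exists']
      intro hs
      rw [← hn] at hs
      exact absurd ((finSuccEquivLast.permCongr τ).injective hs) (by simp)
  rw [this]
  ext i
  simp

theorem sLast_top {M k : ℕ} (l : (Fin (M + 1) → ℕ) → ℕ) (w : Fin (M + 1) → ℕ)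
    (τ : Equiv.Perm (Fin (M + 1))) (hl : ∀ x, (∀ i, x i ≤ k) → ∀ i : Fin _, x i = k → l x ≠ (i : ℕ))
    (hw : ∀ i, i ≠ τ.symm (Fin.last M) → w i < k) (hwk : w (τ.symm (Fin.last M)) = k) :
    sLast l w τ = 0 := by
  refine if_neg fun h => ?_
  obtain ⟨j, hj, hj2⟩ := h (τ.symm (Fin.last M)) (Fin.is_lt _)
  have hlast : sVert w τ j (τ.symm (Fin.last M)) = k := by
    simp only [sVert, Equiv.apply_symm_apply, Fin.val_last, hwk, sInd]
    rw [if_neg (by omega), add_zero]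
  refine hl (sVert w τ j) (fun i => ?_) _ hlast hj2
  by_cases hi : i = τ.symm (Fin.last M)
  · rw [hi, hlast]
  · have := hw i hi
    simp only [sVert, sInd]
    split_ifs <;> omega

theorem sLast_bot {M k : ℕ} (l : (Fin (M + 1) → ℕ) → ℕ) (w : Fin (M + 1) → ℕ)
    (τ : Equiv.Perm (Fin (M + 1))) (hl : ∀ x, (∀ i, x i ≤ k) → ∀ i : Fin _, x i = 0 → l x ≤ (i : ℕ))
    (hw : ∀ i, i ≠ τ.symm (Fin.last M) → w i < k) (hwk : w (τ.symm (Fin.last M)) = 0)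
    (hτ : τ (Fin.last M) ≠ Fin.last M) :
    sLast l w τ = 0 := by
  refine if_neg fun h => ?_
  obtain ⟨j, hj, hj2⟩ := h M (by omega)
  have hlast : sVert w τ j (τ.symm (Fin.last M)) = 0 := by
    simp only [sVert, Equiv.apply_symm_apply, Fin.val_last, hwk, sInd]
    rw [if_neg (by omega)]
  have hle := hl (sVert w τ j) (fun i => ?_) _ hlast
  · have h1 : τ.symm (Fin.last M) ≠ Fin.last M := fun h => hτ (by
      conv_lhs => rw [← h]
      simp)
    have := Fin.val_lt_last h1
    omega
  by_cases hi : i = τ.symm (Fin.last M)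
  · rw [hi, hlast]; omega
  · have := hw i hi
    simp only [sVert, sInd]
    split_ifs <;> omega

theorem sLast_ext {M : ℕ} (l : (Fin (M + 1) → ℕ) → ℕ) (u : Fin M → ℕ)
    (σ : Equiv.Perm (Fin M)) :
    sLast l (Fin.snoc (α := fun _ => ℕ) u 0) (extPerm σ) =
      sRainbow M (fun j => l (Fin.snoc (α := fun _ => ℕ) (sVert u σ j) 0)) := by
  have hv : ∀ j < M + 1, sVert (Fin.snoc (α := fun _ => ℕ) u 0) (extPerm σ) j =
      Fin.snoc (α := fun _ => ℕ) (sVert u σ j) 0 := by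
    intro j hj
    funext i
    refine Fin.lastCases ?_ (fun i => ?_) i
    · simp only [sVert, extPerm_last, Fin.snoc_last, Fin.val_last, sInd]
      rw [if_neg (by omega)]
    · simp only [sVert, extPerm_castSucc, Fin.snoc_castSucc, Fin.val_castSucc]
  unfold sLast sRainbow
  congr 1
  apply propext
  constructor
  · intro h c hc
    obtain ⟨j, hj, h2⟩ := h c (by omega)
    exact ⟨⟨j, hj⟩, by rw [← h2, hv j hj]⟩
  · intro h c hc
    obtain ⟨j, h2⟩ := h c (by omega)
    exact ⟨j, j.2, by rw [← h2, hv j j.2]⟩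

theorem telescope_zmod2 (f : ℕ → ZMod 2) (k : ℕ) :
    ∑ x : Fin k, (f (x + 1) + f x) = f k + f 0 := by
  rw [Fin.sum_univ_eq_sum_range (fun x => f (x + 1) + f x)]
  have := Finset.sum_range_sub f k
  simpa [CharTwo.sub_eq_add] using this

theorem sperner_cube (k : ℕ) (N : ℕ) : ∀ l : (Fin N → ℕ) → ℕ,
    (∀ x, (∀ i, x i ≤ k) → l x ≤ N) →
    (∀ x, (∀ i, x i ≤ k) → ∀ i : Fin _, x i = 0 → l x ≤ (i : ℕ)) →
    (∀ x, (∀ i, x i ≤ k) → ∀ i : Fin _, x i = k → l x ≠ (i : ℕ)) →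
    ∑ v : Fin N → Fin k, ∑ τ : Equiv.Perm (Fin N),
      sRainbow N (fun j => l (sVert (fun i => (v i : ℕ)) τ j)) = 1 := by
  induction N with
  | zero =>
    intro l hl _ _
    simp only [Finset.univ_unique, Finset.sum_singleton]
    refine if_pos fun c hc => ⟨0, ?_⟩
    have := hl (sVert (fun i => ((default : Fin 0 → Fin k) i : ℕ)) default ((0 : Fin 1) : ℕ))
      (fun i => i.elim0)
    beta_reduce
    omega
  | succ M ih =>
    intro l hl hl0 hlk
    have hvert : ∀ (v : Fin (M + 1) → Fin k) (τ : Equiv.Perm (Fin (M + 1))) (j : ℕ),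
        ∀ i, sVert (fun i => (v i : ℕ)) τ j i ≤ k := by
      intro v τ j i
      have := (v i).2
      simp only [sVert, sInd]
      split_ifs <;> omega
    have h1 : ∀ v : Fin (M + 1) → Fin k, ∑ τ : Equiv.Perm (Fin (M + 1)),
        sRainbow (M + 1) (fun j => l (sVert (fun i => (v i : ℕ)) τ j)) =
        ∑ τ : Equiv.Perm (Fin (M + 1)),
          (sLast l ((fun i => (v i : ℕ)) + Pi.single (τ.symm (Fin.last M)) 1) τ +
            sLast l (fun i => (v i : ℕ)) τ) := by
      intro v
      simp_rw [← sum_sDoor (M + 1) _ (fun j => hl _ (hvert v _ j))]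
      simp_rw [Fin.sum_univ_succ (n := M + 1), Fin.sum_univ_castSucc (n := M)]
      rw [Finset.sum_add_distrib, Finset.sum_add_distrib, Finset.sum_comm (t := (Finset.univ : Finset (Fin M)))]
      rw [Finset.sum_eq_zero (s := (Finset.univ : Finset (Fin M)))
        (fun a _ => sDoor_middle l (fun i => (v i : ℕ)) a), zero_add]
      rw [Finset.sum_add_distrib]
      congr 1
      · rw [← Equiv.sum_comp (Equiv.mulLeft (finRotate (M + 1)))]
        exact Finset.sum_congr rfl fun τ _ => sDoor_zero l _ τ
      · exact Finset.sum_congr rfl fun τ _ => sDoor_last l _ τ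
    simp_rw [h1]
    rw [Finset.sum_comm]
    have h2 : ∀ τ : Equiv.Perm (Fin (M + 1)), ∑ v : Fin (M + 1) → Fin k,
        (sLast l ((fun i => (v i : ℕ)) + Pi.single (τ.symm (Fin.last M)) 1) τ +
            sLast l (fun i => (v i : ℕ)) τ) =
        ∑ u : Fin M → Fin k, sLast l
          ((τ.symm (Fin.last M)).insertNth (α := fun _ => ℕ) 0 (fun i => (u i : ℕ))) τ := by
      intro τ
      set i0 := τ.symm (Fin.last M) with hi0
      rw [← (Fin.insertNthEquiv (fun _ => Fin k) i0).sum_comp, Fintype.sum_prod_type,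
        Finset.sum_comm]
      refine Finset.sum_congr rfl fun u _ => ?_
      have e1 : ∀ x : Fin k, (fun i => ((Fin.insertNthEquiv (fun _ => Fin k) i0 (x, u) i : Fin k) : ℕ))
          = i0.insertNth (α := fun _ => ℕ) (x : ℕ) (fun i => (u i : ℕ)) := by
        intro x
        funext i
        refine Fin.succAboveCases i0 ?_ (fun i => ?_) i <;> simp
      have e2 : ∀ x : ℕ, i0.insertNth (α := fun _ => ℕ) x (fun i => (u i : ℕ)) + Pi.single i0 1
          = i0.insertNth (α := fun _ => ℕ) (x + 1) (fun i => (u i : ℕ)) := by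
        intro x
        funext i
        refine Fin.succAboveCases i0 ?_ (fun i => ?_) i <;> simp
      simp_rw [e1, e2]
      rw [telescope_zmod2 (fun x => sLast l (i0.insertNth (α := fun _ => ℕ) x
        (fun i => (u i : ℕ))) τ) k]
      rw [sLast_top (k := k) l _ τ hlk ?_ ?_, zero_add]
      · intro i hi
        rw [← hi0] at hi
        obtain ⟨i', rfl⟩ := Fin.exists_succAbove_eq hi
        simp
      · simp [← hi0]
    simp_rw [h2]
    rw [Finset.sum_comm]
    have h3 : ∀ u : Fin M → Fin k, ∑ τ : Equiv.Perm (Fin (M + 1)), sLast l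
          ((τ.symm (Fin.last M)).insertNth (α := fun _ => ℕ) 0 (fun i => (u i : ℕ))) τ =
        ∑ σ : Equiv.Perm (Fin M),
          sRainbow M (fun j => l (Fin.snoc (α := fun _ => ℕ)
            (sVert (fun i => (u i : ℕ)) σ j) 0)) := by
      intro u
      rw [sum_perm_last]
      · refine Finset.sum_congr rfl fun σ _ => ?_
        have : (extPerm σ).symm (Fin.last M) = Fin.last M := by
          rw [Equiv.symm_apply_eq, extPerm_last]
        rw [this, Fin.insertNth_last', sLast_ext]
      · intro τ hτ
        refine sLast_bot (k := k) l _ τ hl0 ?_ ?_ hτ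
        · intro i hi
          obtain ⟨i', rfl⟩ := Fin.exists_succAbove_eq hi
          simp
        · simp
    simp_rw [h3]
    have hsn : ∀ x : Fin M → ℕ, (∀ i, x i ≤ k) →
        ∀ i, (Fin.snoc (α := fun _ => ℕ) x 0 : Fin (M + 1) → ℕ) i ≤ k := by
      intro x hx i
      refine Fin.lastCases ?_ (fun i => ?_) i
      · simp
      · simpa using hx i
    refine ih (fun x => l (Fin.snoc (α := fun _ => ℕ) x 0)) ?_ ?_ ?_
    · intro x hx
      simpa using hl0 _ (hsn x hx) (Fin.last M) (by simp)
    · intro x hx i hi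
      simpa using hl0 _ (hsn x hx) i.castSucc (by simpa using hi)
    · intro x hx i hi
      simpa using hlk _ (hsn x hx) i.castSucc (by simpa using hi)


/-! ### Covering dimension -/

/-- Every finite open cover of `F` has an open shrinking of order at most `n` on `F`. -/
def CovOn (n : ℕ) {X : Type} [TopologicalSpace X] (F : Set X) : Prop :=
  ∀ (ι : Type) [Finite ι] (U : ι → Set X), (∀ i, IsOpen (U i)) → F ⊆ ⋃ i, U i →
    ∃ V : ι → Set X, (∀ i, IsOpen (V i)) ∧ (∀ i, V i ⊆ U i) ∧ F ⊆ (⋃ i, V i) ∧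
      ∀ x ∈ F, {i | x ∈ V i}.ncard ≤ n

theorem covOn_empty (n : ℕ) {X : Type} [TopologicalSpace X] : CovOn n (∅ : Set X) := by
  intro ι _ U hU _
  exact ⟨U, hU, fun i => le_rfl, by simp, by simp⟩

theorem CovOn.shrink {n : ℕ} {X : Type} [TopologicalSpace X] {F : Set X} (h : CovOn n F)
    (hF : IsClosed F) {ι : Type} [Finite ι] (U : ι → Set X) (hU : ∀ i, IsOpen (U i))
    (hc : F ⊆ ⋃ i, U i) : ∃ V : ι → Set X, (∀ i, IsOpen (V i)) ∧ (∀ i, V i ⊆ U i) ∧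
      (⋃ i, U i) ⊆ (⋃ i, V i) ∧ ∀ x ∈ F, {i | x ∈ V i}.ncard ≤ n := by
  obtain ⟨V, hV, hVU, hcV, hord⟩ := h ι U hU hc
  refine ⟨fun i => (U i \ F) ∪ V i, fun i => ((hU i).sdiff hF).union (hV i),
    fun i => union_subset diff_subset (hVU i), ?_, ?_⟩
  · intro x hx
    by_cases hxF : x ∈ F
    · obtain ⟨i, hi⟩ := mem_iUnion.1 (hcV hxF)
      exact mem_iUnion.2 ⟨i, Or.inr hi⟩
    · obtain ⟨i, hi⟩ := mem_iUnion.1 hx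
      exact mem_iUnion.2 ⟨i, Or.inl ⟨hi, hxF⟩⟩
  · intro x hx
    have : {i | x ∈ (U i \ F) ∪ V i} = {i | x ∈ V i} := by
      ext i; simp [hx]
    rw [this]
    exact hord x hx

theorem CovOn.union {n : ℕ} {X : Type} [TopologicalSpace X] {F G : Set X} (h : CovOn n F)
    (hF : IsClosed F) (h' : CovOn n G) (hG : IsClosed G) : CovOn n (F ∪ G) := by
  intro ι _ U hU hc
  obtain ⟨V, hV, hVU, hcV, hord⟩ := h.shrink hF U hU (subset_union_left.trans hc)
  obtain ⟨W, hW, hWV, hcW, hord'⟩ := h'.shrink hG V hV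
    ((subset_union_right.trans hc).trans hcV)
  refine ⟨W, hW, fun i => (hWV i).trans (hVU i), (hc.trans hcV).trans hcW, ?_⟩
  rintro x (hx | hx)
  · exact (ncard_le_ncard (fun i hi => hWV i hi) (toFinite _)).trans (hord x hx)
  · exact hord' x hx

theorem covOn_iUnion {n k : ℕ} {X : Type} [TopologicalSpace X] (F : Fin k → Set X)
    (h : ∀ j, CovOn n (F j)) (hF : ∀ j, IsClosed (F j)) : CovOn n (⋃ j, F j) := by
  induction k with
  | zero => simpa using covOn_empty n
  | succ k ih =>
    have : (⋃ j, F j) = F 0 ∪ ⋃ j : Fin k, F j.succ := by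
      ext x; simp [Fin.exists_fin_succ]
    rw [this]
    exact (h 0).union (hF 0) (ih (fun j => F j.succ) (fun j => h _) fun j => hF _)
      (isClosed_iUnion_of_finite fun j => hF _)

theorem covOn_of_subtype {n : ℕ} {X : Type} [TopologicalSpace X] {F : Set X}
    (h : CovOn n (univ : Set F)) : CovOn n F := by
  intro ι _ U hU hc
  obtain ⟨V, hV, hVU, hcV, hord⟩ := h ι (fun i => Subtype.val ⁻¹' U i)
    (fun i => (hU i).preimage continuous_subtype_val) (by
      intro x _
      obtain ⟨i, hi⟩ := mem_iUnion.1 (hc x.2)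
      exact mem_iUnion.2 ⟨i, hi⟩)
  choose O hO hOV using fun i => isOpen_induced_iff.1 (hV i)
  have hmem : ∀ (x : X) (hx : x ∈ F) i, x ∈ O i ∩ U i ↔ (⟨x, hx⟩ : F) ∈ V i := by
    intro x hx i
    constructor
    · rintro ⟨h1, _⟩
      rw [← hOV i]; exact h1
    · intro h1
      refine ⟨?_, hVU i h1⟩
      rw [← hOV i] at h1; exact h1
  refine ⟨fun i => O i ∩ U i, fun i => (hO i).inter (hU i), fun i => inter_subset_right, ?_, ?_⟩
  · intro x hx
    obtain ⟨i, hi⟩ := mem_iUnion.1 (hcV (mem_univ (⟨x, hx⟩ : F)))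
    exact mem_iUnion.2 ⟨i, (hmem x hx i).2 hi⟩
  · intro x hx
    have := hord ⟨x, hx⟩ (mem_univ _)
    simpa only [hmem x hx] using this

/-- Extension of an open family of bounded order from a compact set. -/
theorem exists_extension {n : ℕ} {X : Type} [MetricSpace X] {F : Set X} (hF : IsCompact F)
    {ι : Type} [Finite ι] (V : ι → Set X) (hV : ∀ i, IsOpen (V i)) (hc : F ⊆ ⋃ i, V i)
    (hord : ∀ x ∈ F, {i | x ∈ V i}.ncard ≤ n) :
    ∃ O : ι → Set X, (∀ i, IsOpen (O i)) ∧ (∀ i, O i ⊆ V i) ∧ F ⊆ (⋃ i, O i) ∧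
      ∀ x, {i | x ∈ O i}.ncard ≤ n := by
  refine ⟨fun i => {x | Metric.infEDist x F < Metric.infEDist x (F \ V i)} ∩ V i, fun i =>
    (isOpen_lt Metric.continuous_infEDist Metric.continuous_infEDist).inter (hV i),
    fun i => inter_subset_right, ?_, ?_⟩
  · intro x hx
    obtain ⟨i, hi⟩ := mem_iUnion.1 (hc hx)
    refine mem_iUnion.2 ⟨i, ?_, hi⟩
    show Metric.infEDist x F < Metric.infEDist x (F \ V i)
    rw [Metric.infEDist_zero_of_mem hx]
    have hcl : IsClosed (F \ V i) := hF.isClosed.sdiff (hV i)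
    exact Metric.infEDist_pos_iff_notMem_closure.2 (by rw [hcl.closure_eq]; exact fun h => h.2 hi)
  · intro x
    rcases F.eq_empty_or_nonempty with he | hne
    · simp [he]
    · obtain ⟨y, hy, hxy⟩ := hF.exists_infEDist_eq_edist hne x
      refine (ncard_le_ncard ?_ (toFinite _)).trans (hord y hy)
      rintro i ⟨hi, _⟩
      by_contra hyi
      have h1 : Metric.infEDist x (F \ V i) ≤ edist x y := Metric.infEDist_le_edist_of_mem ⟨hy, hyi⟩
      rw [← hxy] at h1
      exact absurd hi (not_lt.2 h1)

theorem covOn_succ_of_basis {n : ℕ} {X : Type} [MetricSpace X] [CompactSpace X]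
    {B : Set (Set X)} (hB : IsTopologicalBasis B) (h : ∀ U ∈ B, CovOn n (frontier U)) :
    CovOn (n + 1) (univ : Set X) := by
  intro ι _ U hU hc
  have hch : ∀ x : X, ∃ i, ∃ G ∈ B, x ∈ G ∧ G ⊆ U i := by
    intro x
    obtain ⟨i, hi⟩ := mem_iUnion.1 (hc (mem_univ x))
    obtain ⟨G, hG, hxG, hGU⟩ := hB.exists_subset_of_mem_open hi (hU i)
    exact ⟨i, G, hG, hxG, hGU⟩
  choose i0 G0 hG0B hxG0 hG0U using hch
  obtain ⟨T, hT⟩ := isCompact_univ.elim_finite_subcover G0 (fun x => hB.isOpen (hG0B x))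
    (fun x _ => mem_iUnion.2 ⟨x, hxG0 x⟩)
  let e := T.equivFin.symm
  let G : Fin T.card → Set X := fun j => G0 (e j)
  let c : Fin T.card → ι := fun j => i0 (e j)
  have hGo : ∀ j, IsOpen (G j) := fun j => hB.isOpen (hG0B _)
  have hGU : ∀ j, G j ⊆ U (c j) := fun j => hG0U _
  have hGc : ∀ x, ∃ j, x ∈ G j := by
    intro x
    obtain ⟨t, ht, hxt⟩ := mem_iUnion₂.1 (hT (mem_univ x))
    exact ⟨e.symm ⟨t, ht⟩, by simpa [G] using hxt⟩
  set F : Set X := ⋃ j, frontier (G j) with hFdef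
  have hFcl : IsClosed F := isClosed_iUnion_of_finite fun j => isClosed_frontier
  have hFcov : CovOn n F := covOn_iUnion _ (fun j => h _ (hG0B _)) fun j => isClosed_frontier
  obtain ⟨V, hV, hVU, hcV, hord⟩ := hFcov ι U hU ((subset_univ _).trans hc)
  obtain ⟨O, hO, hOV, hcO, hordO⟩ := exists_extension hFcl.isCompact V hV hcV hord
  let H : Fin T.card → Set X := fun j => G j \ ⋃ l : {l // l < j}, closure (G l)
  have hHo : ∀ j, IsOpen (H j) := fun j =>
    (hGo j).sdiff (isClosed_iUnion_of_finite fun l => isClosed_closure)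
  have hHd : ∀ x j l, x ∈ H j → x ∈ H l → j = l := by
    have : ∀ x j l, x ∈ H j → x ∈ H l → ¬ l < j := fun x j l hj hl hlt =>
      hj.2 (mem_iUnion.2 ⟨⟨l, hlt⟩, subset_closure hl.1⟩)
    intro x j l hj hl
    exact le_antisymm (not_lt.1 (this x j l hj hl)) (not_lt.1 (this x l j hl hj))
  refine ⟨fun i => O i ∪ ⋃ j : {j // c j = i}, H j, fun i => (hO i).union
    (isOpen_iUnion fun j => hHo j), fun i => union_subset ((hOV i).trans (hVU i)) ?_, ?_, ?_⟩
  · refine iUnion_subset ?_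
    rintro ⟨j, rfl⟩
    exact diff_subset.trans (hGU j)
  · intro x _
    by_cases hx : x ∈ F
    · obtain ⟨i, hi⟩ := mem_iUnion.1 (hcO hx)
      exact mem_iUnion.2 ⟨i, Or.inl hi⟩
    · classical
      let p : ℕ → Prop := fun m => ∃ hm : m < T.card, x ∈ G ⟨m, hm⟩
      have hp : ∃ m, p m := by
        obtain ⟨j, hj⟩ := hGc x
        exact ⟨j, j.2, hj⟩
      obtain ⟨hm, hxm⟩ := Nat.find_spec hp
      refine mem_iUnion.2 ⟨c ⟨Nat.find hp, hm⟩, Or.inr (mem_iUnion.2 ⟨⟨_, rfl⟩, hxm, ?_⟩)⟩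
      intro hcl
      obtain ⟨⟨l, hl⟩, hxl⟩ := mem_iUnion.1 hcl
      have hnot : x ∉ G l := fun hh => Nat.find_min hp (m := l) hl ⟨l.2, hh⟩
      refine hx (mem_iUnion.2 ⟨l, ?_⟩)
      rw [(hGo l).frontier_eq]
      exact ⟨hxl, hnot⟩
  · intro x _
    have hsub : {i | x ∈ O i ∪ ⋃ j : {j // c j = i}, H j} ⊆
        {i | x ∈ O i} ∪ {i | ∃ j, c j = i ∧ x ∈ H j} := by
      rintro i (hi | hi)
      · exact Or.inl hi
      · obtain ⟨⟨j, hj⟩, hx⟩ := mem_iUnion.1 hi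
        exact Or.inr ⟨j, hj, hx⟩
    refine (ncard_le_ncard hsub (toFinite _)).trans ((ncard_union_le _ _).trans ?_)
    refine Nat.add_le_add (hordO x) ?_
    rw [ncard_le_one (toFinite _)]
    rintro _ ⟨j, rfl, hj⟩ _ ⟨l, rfl, hl⟩
    rw [hHd x j l hj hl]

theorem covOn_of_indLe (n : ℕ) : ∀ (X : Type) [MetricSpace X] [CompactSpace X],
    indLe n X → CovOn (n + 1) (univ : Set X) := by
  induction n with
  | zero =>
    rintro X _ _ ⟨B, hB, h⟩
    exact covOn_succ_of_basis hB fun U hU => by rw [h U hU]; exact covOn_empty _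
  | succ n ih =>
    rintro X _ _ ⟨B, hB, h⟩
    refine covOn_succ_of_basis hB fun U hU => covOn_of_subtype ?_
    have : CompactSpace ↥(frontier U) :=
      isCompact_iff_compactSpace.1 isClosed_frontier.isCompact
    exact ih _ (h U hU)

/-- Grid points. -/
noncomputable def gridPt {N : ℕ} (k : ℕ) (x : Fin N → ℕ) : Fin N → unitInterval :=
  fun i => Set.projIcc 0 1 zero_le_one ((x i : ℝ) / k)

theorem gridPt_zero {N : ℕ} (k : ℕ) (x : Fin N → ℕ) (i : Fin N) (h : x i = 0) :
    gridPt k x i = 0 := by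
  simp [gridPt, h]

theorem gridPt_top {N : ℕ} (k : ℕ) (hk : 0 < k) (x : Fin N → ℕ) (i : Fin N) (h : x i = k) :
    gridPt k x i = 1 := by
  have : (k : ℝ) ≠ 0 := by positivity
  simp [gridPt, h, this]

theorem dist_gridPt {N : ℕ} (k : ℕ) (hk : 0 < k) (v : Fin N → ℕ) (τ τ' : Equiv.Perm (Fin N))
    (j j' : ℕ) : dist (gridPt k (sVert v τ j)) (gridPt k (sVert v τ' j')) ≤ 1 / k := by
  have hk' : (0 : ℝ) < k := by positivity
  refine (dist_pi_le_iff (by positivity)).2 fun i => ?_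
  have hL := (LipschitzWith.projIcc (a := (0:ℝ)) (b := 1) zero_le_one).dist_le_mul
    ((sVert v τ j i : ℝ) / k) ((sVert v τ' j' i : ℝ) / k)
  refine hL.trans ?_
  have key : |((sVert v τ j i : ℕ) : ℝ) - ((sVert v τ' j' i : ℕ) : ℝ)| ≤ 1 := by
    simp only [sVert, sInd]
    split_ifs <;> simp
  have e : ((sVert v τ j i : ℕ) : ℝ) / k - ((sVert v τ' j' i : ℕ) : ℝ) / k =
      (((sVert v τ j i : ℕ) : ℝ) - ((sVert v τ' j' i : ℕ) : ℝ)) / k := by ring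
  have e2 : |((sVert v τ j i : ℕ) : ℝ) / k - ((sVert v τ' j' i : ℕ) : ℝ) / k| ≤ 1 / k := by
    rw [e, abs_div, abs_of_pos hk']
    exact div_le_div_of_nonneg_right key hk'.le
  rw [NNReal.coe_one, one_mul]
  exact e2

theorem not_covOn_cube (N : ℕ) : ¬ CovOn N (univ : Set (Fin N → unitInterval)) := by
  intro h
  let U : Fin (N + 1) → Set (Fin N → unitInterval) := fun c =>
    {x | ∀ i : Fin N, ((i : ℕ) = c → x i ≠ 1) ∧ ((i : ℕ) < c → x i ≠ 0)}
  have hU : ∀ c, IsOpen (U c) := by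
    intro c
    simp only [U, setOf_forall, setOf_and]
    refine isOpen_iInter_of_finite fun i => IsOpen.inter ?_ ?_
    · by_cases hc : (i : ℕ) = c
      · simpa [hc] using isOpen_ne.preimage (continuous_apply i)
      · simp [hc]
    · by_cases hc : (i : ℕ) < c
      · simpa [hc] using isOpen_ne.preimage (continuous_apply i)
      · simp [hc]
  have hcU : (univ : Set (Fin N → unitInterval)) ⊆ ⋃ c, U c := by
    classical
    intro x _
    by_cases hx : ∃ m, ∃ hm : m < N, x ⟨m, hm⟩ = 0
    · obtain ⟨hm, hm2⟩ := Nat.find_spec hx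
      refine mem_iUnion.2 ⟨⟨Nat.find hx, by omega⟩, fun i => ⟨?_, ?_⟩⟩
      · intro hi
        have : i = ⟨Nat.find hx, hm⟩ := Fin.ext hi
        rw [this, hm2]; simp
      · intro hi h0
        exact Nat.find_min hx (m := i) hi ⟨i.2, h0⟩
    · push Not at hx
      refine mem_iUnion.2 ⟨Fin.last N, fun i => ⟨?_, fun _ => hx i i.2⟩⟩
      intro hi
      have := i.2
      simp at hi
      omega
  obtain ⟨V, hV, hVU, hcV, hord⟩ := h _ U hU hcU
  obtain ⟨δ, hδ, hleb⟩ := lebesgue_number_lemma_of_metric isCompact_univ hV hcV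
  choose lab hlab using fun x : Fin N → unitInterval => hleb x (mem_univ x)
  obtain ⟨k, hk⟩ := exists_nat_one_div_lt hδ
  have hk1 : 0 < k + 1 := by omega
  let l : (Fin N → ℕ) → ℕ := fun x => lab (gridPt (k + 1) x)
  have hlU : ∀ x, gridPt (k + 1) x ∈ U (lab (gridPt (k + 1) x)) := fun x =>
    hVU _ (hlab _ (Metric.mem_ball_self hδ))
  have hs := sperner_cube (k + 1) N l (fun x _ => Nat.lt_succ_iff.1 (lab (gridPt (k + 1) x)).2)
    (fun x _ i hi => by
      by_contra hc
      exact (hlU x i).2 (not_le.1 hc) (gridPt_zero _ x i hi))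
    (fun x _ i hi hc => (hlU x i).1 hc.symm (gridPt_top _ hk1 x i hi))
  obtain ⟨v, _, hv⟩ := Finset.exists_ne_zero_of_sum_ne_zero (by rw [hs]; exact one_ne_zero)
  obtain ⟨τ, _, hτ⟩ := Finset.exists_ne_zero_of_sum_ne_zero hv
  have hr : ∀ c ≤ N, ∃ j : Fin (N + 1), l (sVert (fun i => (v i : ℕ)) τ j) = c := by
    by_contra hc
    exact hτ (if_neg hc)
  let z := gridPt (k + 1) (sVert (fun i => (v i : ℕ)) τ 0)
  have hz : ∀ c, z ∈ V c := by
    intro c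
    obtain ⟨j, hj⟩ := hr c (by omega)
    have hc : lab (gridPt (k + 1) (sVert (fun i => (v i : ℕ)) τ j)) = c := Fin.ext hj
    rw [← hc]
    refine hlab _ ?_
    rw [Metric.mem_ball]
    refine (dist_gridPt (k + 1) hk1 _ _ _ _ _).trans_lt ?_
    simpa using hk
  have := hord z (mem_univ _)
  have hz' : {i | z ∈ V i} = univ := by ext i; simp [hz i]
  rw [hz', ncard_univ] at this
  simp at this

/-- The `n+1`-dimensional cube does not have small inductive dimension at most `n`. -/
theorem not_indLe_cube (n : ℕ) : ¬ indLe n (Fin (n + 1) → unitInterval) := fun h =>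
  not_covOn_cube (n + 1) (covOn_of_indLe n _ h)


/-! ### Cantor spaces with prescribed scales -/

/-- A sequence of scales decreasing to zero. -/
structure CScale where
  /-- the scales -/
  a : ℕ → ℝ
  pos : ∀ k, 0 < a k
  anti : Antitone a
  lim : Tendsto a atTop (𝓝 0)

/-- The Cantor space with the ultrametric of the given scales. -/
def Cant (_S : CScale) : Type := ℕ → Bool

/-- The identity map. -/
def toCant (S : CScale) : (ℕ → Bool) ≃ Cant S := Equiv.refl _

/-- The distance on the Cantor space. -/
noncomputable def cdist (S : CScale) (x y : ℕ → Bool) : ℝ :=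
  open Classical in if x = y then 0 else S.a (PiNat.firstDiff x y)

theorem cdist_ne (S : CScale) {x y : ℕ → Bool} (h : x ≠ y) :
    cdist S x y = S.a (PiNat.firstDiff x y) := if_neg h

theorem cdist_nonneg (S : CScale) (x y : ℕ → Bool) : 0 ≤ cdist S x y := by
  unfold cdist; split_ifs
  · exact le_rfl
  · exact (S.pos _).le

theorem cdist_self (S : CScale) (x : ℕ → Bool) : cdist S x x = 0 := if_pos rfl

theorem cdist_comm (S : CScale) (x y : ℕ → Bool) : cdist S x y = cdist S y x := by
  by_cases h : x = y
  · rw [h]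
  · rw [cdist_ne S h, cdist_ne S (Ne.symm h), PiNat.firstDiff_comm]

theorem cdist_triangle (S : CScale) (x y z : ℕ → Bool) :
    cdist S x z ≤ cdist S x y + cdist S y z := by
  by_cases h1 : x = y
  · subst h1; simp [cdist_self]
  by_cases h2 : y = z
  · subst h2; simp [cdist_self]
  by_cases h : x = z
  · have e : cdist S x z = 0 := if_pos h
    rw [e]
    exact add_nonneg (cdist_nonneg _ _ _) (cdist_nonneg _ _ _)
  rw [cdist_ne S h, cdist_ne S h1, cdist_ne S h2]
  have hm := PiNat.min_firstDiff_le (E := fun _ => Bool) x y z h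
  rcases min_le_iff.1 hm with h3 | h3
  · have := S.anti h3
    have := S.pos (PiNat.firstDiff (E := fun _ => Bool) y z)
    linarith
  · have := S.anti h3
    have := S.pos (PiNat.firstDiff (E := fun _ => Bool) x y)
    linarith

theorem eq_of_cdist (S : CScale) (x y : ℕ → Bool) (h : cdist S x y = 0) : x = y := by
  by_contra hc
  rw [cdist_ne S hc] at h
  exact (S.pos _).ne' h

noncomputable instance (S : CScale) : MetricSpace (Cant S) where
  dist x y := cdist S x y
  dist_self x := cdist_self S x
  dist_comm x y := cdist_comm S x y
  dist_triangle x y z := cdist_triangle S x y z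
  eq_of_dist_eq_zero {x y} h := eq_of_cdist S x y h

theorem cant_dist (S : CScale) (x y : ℕ → Bool) :
    dist (toCant S x) (toCant S y) = cdist S x y := rfl

theorem cdist_le_of_agree (S : CScale) {x y : ℕ → Bool} {k : ℕ} (h : ∀ i < k, x i = y i) :
    cdist S x y ≤ S.a k := by
  by_cases hxy : x = y
  · have e : cdist S x y = 0 := if_pos hxy
    rw [e]
    exact (S.pos _).le
  rw [cdist_ne S hxy]
  refine S.anti ?_
  by_contra hc
  exact PiNat.apply_firstDiff_ne hxy (h _ (not_le.1 hc))

theorem agree_of_cdist_le (S : CScale) {x y : ℕ → Bool} {k : ℕ} {δ : ℝ} (h : cdist S x y ≤ δ)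
    (hk : ∀ j < k, δ < S.a j) : ∀ i < k, x i = y i := by
  intro i hi
  by_cases hxy : x = y
  · rw [hxy]
  rw [cdist_ne S hxy] at h
  refine PiNat.apply_eq_of_lt_firstDiff (lt_of_lt_of_le hi ?_)
  by_contra hc
  exact absurd (hk _ (not_le.1 hc)) (not_lt.2 h)

theorem continuous_toCant (S : CScale) : Continuous (toCant S) := by
  refine continuous_iff_continuousAt.2 fun x => ?_
  rw [Metric.continuousAt_iff']
  intro ε hε
  obtain ⟨k, hk⟩ := (S.lim.eventually (gt_mem_nhds hε)).exists
  have : ∀ᶠ y in 𝓝 x, ∀ i ∈ Finset.range k, y i = x i := by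
    rw [Finset.eventually_all]
    intro i _
    exact (continuous_apply i).continuousAt.eventually (isOpen_discrete {x i} |>.mem_nhds rfl)
  filter_upwards [this] with y hy
  rw [cant_dist]
  exact (cdist_le_of_agree S fun i hi => hy i (Finset.mem_range.2 hi)).trans_lt hk

instance (S : CScale) : CompactSpace (Cant S) :=
  (toCant S).surjective.compactSpace (continuous_toCant S)

/-- The homeomorphism with the standard Cantor space. -/
noncomputable def homeoCant (S : CScale) : (ℕ → Bool) ≃ₜ Cant S :=
  Continuous.homeoOfEquivCompactToT2 (continuous_toCant S)

instance (S : CScale) : Nonempty (Cant S) := ⟨toCant S fun _ => false⟩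

noncomputable instance (S : CScale) : MeasurableSpace (Cant S) := borel _
instance (S : CScale) : BorelSpace (Cant S) := ⟨rfl⟩

/-- The fair coin. -/
noncomputable def coin : Measure Bool := (2⁻¹ : ℝ≥0∞) • Measure.count

instance : IsProbabilityMeasure coin := ⟨by
  rw [coin, Measure.smul_apply, Measure.count_univ]
  simp [ENNReal.inv_mul_cancel]⟩

theorem coin_singleton (b : Bool) : coin {b} = 2⁻¹ := by simp [coin]

/-- The Cantor measure. -/
noncomputable def cantMeas (S : CScale) : Measure (Cant S) :=
  Measure.map (toCant S) (Measure.infinitePi fun _ => coin)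

theorem measurable_toCant (S : CScale) : Measurable (toCant S) := (continuous_toCant S).measurable

instance (S : CScale) : IsProbabilityMeasure (cantMeas S) :=
  Measure.isProbabilityMeasure_map (measurable_toCant S).aemeasurable

theorem coin_cyl (c : ℕ → Bool) (k : ℕ) :
    Measure.infinitePi (fun _ : ℕ => coin) {y | ∀ i < k, y i = c i} = 2⁻¹ ^ k := by
  have : {y : ℕ → Bool | ∀ i < k, y i = c i} =
      Set.pi (Finset.range k : Finset ℕ) fun i => {c i} := by
    ext y; simp [Set.mem_pi]
  rw [this, Measure.infinitePi_pi _ (fun _ _ => measurableSet_singleton _)]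
  simp [coin_singleton]

theorem cantMeas_closedBall_le (S : CScale) (c : Cant S) (k : ℕ) (δ : ℝ)
    (hk : ∀ j < k, δ < S.a j) : cantMeas S (Metric.closedBall c δ) ≤ 2⁻¹ ^ k := by
  rw [cantMeas, Measure.map_apply (measurable_toCant S) Metric.isClosed_closedBall.measurableSet,
    ← coin_cyl ((toCant S).symm c) k]
  refine measure_mono fun y hy => ?_
  exact agree_of_cdist_le S (δ := δ) hy hk

instance (S : CScale) : IsOpenPosMeasure (cantMeas S) := ⟨by
  rintro U hU ⟨c, hc⟩
  obtain ⟨ε, hε, hb⟩ := Metric.isOpen_iff.1 hU c hc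
  obtain ⟨k, hk⟩ := (S.lim.eventually (gt_mem_nhds hε)).exists
  rw [cantMeas, Measure.map_apply (measurable_toCant S) hU.measurableSet]
  refine (lt_of_lt_of_le ?_ (measure_mono (?_ : {y | ∀ i < k, y i = (toCant S).symm c i} ⊆ _))).ne'
  · rw [coin_cyl]
    exact ENNReal.pow_pos (by simp) k
  · intro y hy
    exact hb ((cdist_le_of_agree S hy).trans_lt hk)⟩

instance : IsOpenPosMeasure (volume : Measure unitInterval) := ⟨by
  rintro U hU ⟨x, hx⟩
  obtain ⟨V, hV, rfl⟩ := isOpen_induced_iff.1 hU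
  rw [unitInterval.volume_apply]
  have hne : (V ∩ Ioo (0:ℝ) 1).Nonempty := by
    have hcl : (x : ℝ) ∈ closure (Ioo (0:ℝ) 1) := by
      rw [closure_Ioo zero_ne_one]; exact x.2
    exact mem_closure_iff.1 hcl V hV hx
  have := (hV.inter isOpen_Ioo).measure_pos volume hne
  refine (this.trans_le (measure_mono ?_)).ne'
  rintro y ⟨h1, h2⟩
  exact ⟨⟨y, h2.1.le, h2.2.le⟩, h1, rfl⟩⟩

theorem volume_unitInterval_closedBall_le (x : unitInterval) (δ : ℝ) :
    volume (Metric.closedBall x δ) ≤ ENNReal.ofReal (2 * δ) := by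
  rw [unitInterval.volume_apply, ← Real.volume_closedBall (x : ℝ) δ]
  refine measure_mono ?_
  rintro _ ⟨y, hy, rfl⟩
  exact hy

/-- Scales producing Hausdorff dimension exactly `r`. -/
structure CScale.Adm (S : CScale) (r : ℝ≥0∞) : Prop where
  lower : ∀ q : ℝ≥0, (q : ℝ≥0∞) ≤ r → ∀ᶠ k in atTop, (2⁻¹ : ℝ) ^ k ≤ S.a k ^ (q : ℝ)
  upper : ∀ q : ℝ≥0, r < q → Tendsto (fun k => (2 : ℝ) ^ k * S.a k ^ (q : ℝ)) atTop (𝓝 0)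

theorem exists_scale (r : ℝ≥0∞) : ∃ S : CScale, S.Adm r := by
  rcases eq_or_ne r ⊤ with rfl | hr
  · refine ⟨⟨fun k => 1 / ((k : ℝ) + 1), fun k => by positivity, ?_,
      tendsto_one_div_add_atTop_nhds_zero_nat⟩, ?_, ?_⟩
    · intro i j h
      have : (i : ℝ) ≤ j := by exact_mod_cast h
      exact one_div_le_one_div_of_le (by positivity) (by linarith)
    · intro q _
      obtain ⟨n, hn⟩ := exists_nat_ge (q : ℝ)
      have h1 : Tendsto (fun k : ℕ => ((k : ℝ)) ^ n * (2⁻¹ : ℝ) ^ k) atTop (𝓝 0) :=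
        tendsto_pow_const_mul_const_pow_of_lt_one n (by norm_num) (by norm_num)
      have h2 := (h1.comp (tendsto_add_atTop_nat 1)).eventually (gt_mem_nhds (show (0:ℝ) < 2⁻¹ by norm_num))
      filter_upwards [h2] with k hk
      simp only [Function.comp] at hk
      push_cast at hk
      rw [pow_succ] at hk
      have h3 : ((k : ℝ) + 1) ^ n * 2⁻¹ ^ k ≤ 1 := by
        have : (0:ℝ) ≤ ((k : ℝ) + 1) ^ n * 2⁻¹ ^ k := by positivity
        nlinarith
      rw [one_div, Real.inv_rpow (by positivity)]
      have h4 : ((k : ℝ) + 1) ^ (q : ℝ) ≤ ((k : ℝ) + 1) ^ n := by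
        rw [← Real.rpow_natCast]
        exact Real.rpow_le_rpow_of_exponent_le (by linarith [(Nat.cast_nonneg k : (0:ℝ) ≤ k)]) hn
      have h5 : (0:ℝ) < ((k : ℝ) + 1) ^ (q : ℝ) := by positivity
      rw [inv_eq_one_div ((_ : ℝ) ^ (q : ℝ)), le_div_iff₀ h5]
      refine le_trans ?_ h3
      rw [mul_comm]
      gcongr
    · intro q hq
      exact absurd hq (by simp)
  rcases eq_or_ne r 0 with rfl | hr0
  · refine ⟨⟨fun k => 1 / (k.factorial : ℝ), fun k => by positivity, ?_, ?_⟩, ?_, ?_⟩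
    · intro i j h
      have : (i.factorial : ℝ) ≤ j.factorial := by exact_mod_cast Nat.factorial_le h
      exact one_div_le_one_div_of_le (by positivity) this
    · simpa using FloorSemiring.tendsto_pow_div_factorial_atTop (1 : ℝ)
    · intro q hq
      have : q = 0 := by simpa using hq
      subst this
      refine Eventually.of_forall fun k => ?_
      simp only [NNReal.coe_zero, Real.rpow_zero]
      exact pow_le_one₀ (by norm_num) (by norm_num)
    · intro q hq
      have hq' : 0 < (q : ℝ) := by exact_mod_cast hq
      have h1 := FloorSemiring.tendsto_pow_div_factorial_atTop ((2 : ℝ) ^ (1 / (q : ℝ)))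
      have h2 : Tendsto (fun x : ℝ => x ^ (q : ℝ)) (𝓝 0) (𝓝 0) := by
        have := (Real.continuousAt_rpow_const 0 (q : ℝ) (Or.inr hq'.le)).tendsto
        rwa [Real.zero_rpow hq'.ne'] at this
      refine (h2.comp h1).congr fun k => ?_
      simp only [Function.comp]
      rw [div_eq_mul_one_div, Real.mul_rpow (pow_nonneg (Real.rpow_nonneg (by norm_num) _) _) (by positivity)]
      congr 1
      rw [← Real.rpow_natCast, ← Real.rpow_natCast, ← Real.rpow_mul (Real.rpow_nonneg (by norm_num) _),
        ← Real.rpow_mul (by norm_num)]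
      congr 1
      field_simp
  · lift r to ℝ≥0 using hr
    have hr' : 0 < (r : ℝ) := by
      have : 0 < r := pos_iff_ne_zero.2 (by simpa using hr0)
      exact_mod_cast this
    set b : ℝ := (2 : ℝ) ^ (-(1 / (r : ℝ))) with hb
    have hb0 : 0 < b := by positivity
    have hb1 : b < 1 := by
      refine Real.rpow_lt_one_of_one_lt_of_neg (by norm_num) ?_
      have : 0 < 1 / (r : ℝ) := by positivity
      linarith
    have hbr : b ^ (r : ℝ) = 2⁻¹ := by
      rw [hb, ← Real.rpow_mul (by norm_num)]
      have : -(1 / (r : ℝ)) * r = -1 := by field_simp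
      rw [this, Real.rpow_neg_one]
    have hsw : ∀ (k : ℕ) (q : ℝ), (b ^ k) ^ q = (b ^ q) ^ k := by
      intro k q
      rw [← Real.rpow_natCast, ← Real.rpow_natCast, ← Real.rpow_mul hb0.le,
        ← Real.rpow_mul hb0.le, mul_comm]
    refine ⟨⟨fun k => b ^ k, fun k => by positivity, ?_, ?_⟩, ?_, ?_⟩
    · exact fun i j h => pow_le_pow_of_le_one hb0.le hb1.le h
    · exact tendsto_pow_atTop_nhds_zero_of_lt_one hb0.le hb1
    · intro q hq
      have hq' : (q : ℝ) ≤ r := by exact_mod_cast hq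
      refine Eventually.of_forall fun k => ?_
      simp only
      rw [hsw, ← hbr]
      refine pow_le_pow_left₀ (by positivity) ?_ k
      exact Real.rpow_le_rpow_of_exponent_ge hb0 hb1.le hq'
    · intro q hq
      have hq' : (r : ℝ) < q := by exact_mod_cast hq
      have h1 : 2 * b ^ (q : ℝ) < 1 := by
        have := Real.rpow_lt_rpow_of_exponent_gt hb0 hb1 hq'
        rw [hbr] at this
        linarith
      refine (tendsto_pow_atTop_nhds_zero_of_lt_one (by positivity) h1).congr fun k => ?_
      simp only
      rw [hsw, mul_pow]


/-! ### Products of Cantor spaces with cubes -/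

/-- Product of a Cantor space with a cube. -/
abbrev Box (S : CScale) (N : ℕ) : Type := Cant S × (Fin N → unitInterval)

/-- The pieces of the cover at level `k`. -/
def boxPiece (S : CScale) (N M k : ℕ) (p : (Fin k → Bool) × (Fin N → Fin (M + 1))) :
    Set (Box S N) :=
  {z | (∀ i : Fin k, (toCant S).symm z.1 i = p.1 i) ∧
    ∀ j, ((p.2 j : ℕ) : ℝ) ≤ (z.2 j : ℝ) * M ∧ (z.2 j : ℝ) * M ≤ (p.2 j : ℕ) + 1}

theorem boxPiece_cover (S : CScale) (N M k : ℕ) : (univ : Set (Box S N)) ⊆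
    ⋃ p, boxPiece S N M k p := by
  intro z _
  refine mem_iUnion.2 ⟨(fun i => (toCant S).symm z.1 i, fun j =>
    ⟨⌊(z.2 j : ℝ) * M⌋₊, ?_⟩), fun i => rfl, fun j => ⟨?_, ?_⟩⟩
  · have h1 := (z.2 j).2.1
    have h2 := (z.2 j).2.2
    have : ((z.2 j : ℝ)) * M ≤ M := by
      have : (0:ℝ) ≤ M := by positivity
      nlinarith
    exact Nat.lt_succ_of_le (Nat.floor_le_of_le this)
  · exact Nat.floor_le (mul_nonneg (z.2 j).2.1 (by positivity))
  · exact (Nat.lt_floor_add_one _).le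

theorem boxPiece_ediam (S : CScale) (N M k : ℕ) (hM : 1 / S.a k ≤ M)
    (p : (Fin k → Bool) × (Fin N → Fin (M + 1))) :
    Metric.ediam (boxPiece S N M k p) ≤ ENNReal.ofReal (S.a k) := by
  refine Metric.ediam_le fun z hz w hw => ?_
  rw [edist_dist]
  refine ENNReal.ofReal_le_ofReal ?_
  have ha := S.pos k
  rw [Prod.dist_eq]
  refine max_le ?_ ?_
  · exact cdist_le_of_agree S fun i hi => (hz.1 ⟨i, hi⟩).trans (hw.1 ⟨i, hi⟩).symm
  · refine (dist_pi_le_iff ha.le).2 fun j => ?_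
    have h1 := hz.2 j
    have h2 := hw.2 j
    have hM0 : (0:ℝ) < M := lt_of_lt_of_le (by positivity) hM
    have hM1 : 1 ≤ M * S.a k := by rwa [div_le_iff₀ ha] at hM
    rw [Subtype.dist_eq, Real.dist_eq, abs_le]
    constructor
    · by_contra hc
      push Not at hc
      nlinarith
    · by_contra hc
      push Not at hc
      nlinarith

theorem box_hausdorff_zero (S : CScale) (N : ℕ) (q : ℝ≥0)
    (h : Tendsto (fun k => (2 : ℝ) ^ k * S.a k ^ (q : ℝ)) atTop (𝓝 0)) :
    μH[(q : ℝ) + N] (univ : Set (Box S N)) = 0 := by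
  refine le_antisymm ?_ (zero_le)
  let M : ℕ → ℕ := fun k => ⌈1 / S.a k⌉₊
  have hlim : Tendsto (fun k => ENNReal.ofReal (S.a k)) atTop (𝓝 0) := by
    have := ENNReal.tendsto_ofReal S.lim
    simpa using this
  refine (hausdorffMeasure_le_liminf_sum (ι := fun k => (Fin k → Bool) × (Fin N → Fin (M k + 1)))
    _ _ (fun k => ENNReal.ofReal (S.a k)) hlim (fun k => boxPiece S N (M k) k)
    (Eventually.of_forall fun k p => boxPiece_ediam S N (M k) k (Nat.le_ceil _) p)
    (Eventually.of_forall fun k => boxPiece_cover S N (M k) k)).trans ?_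
  have hup : ∀ᶠ k in atTop, ∑ p, Metric.ediam (boxPiece S N (M k) k p) ^ ((q : ℝ) + N) ≤
      ENNReal.ofReal (3 ^ N * (2 ^ k * S.a k ^ (q : ℝ))) := by
    filter_upwards [S.lim.eventually (gt_mem_nhds (zero_lt_one))] with k hk
    have ha := S.pos k
    calc ∑ p, Metric.ediam (boxPiece S N (M k) k p) ^ ((q : ℝ) + N)
        ≤ ∑ p : (Fin k → Bool) × (Fin N → Fin (M k + 1)),
          ENNReal.ofReal (S.a k) ^ ((q : ℝ) + N) := by
          refine Finset.sum_le_sum fun p _ => ?_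
          exact ENNReal.rpow_le_rpow (boxPiece_ediam S N (M k) k (Nat.le_ceil _) p) (by positivity)
      _ = ENNReal.ofReal (2 ^ k * ((M k : ℝ) + 1) ^ N * S.a k ^ ((q : ℝ) + N)) := by
          rw [Finset.sum_const, Finset.card_univ, nsmul_eq_mul,
            ENNReal.ofReal_rpow_of_pos ha, ENNReal.ofReal_mul (by positivity)]
          congr 1
          simp only [Fintype.card_prod, Fintype.card_fun, Fintype.card_bool, Fintype.card_fin]
          rw [← ENNReal.ofReal_natCast]
          push_cast
          rfl
      _ ≤ _ := by
          refine ENNReal.ofReal_le_ofReal ?_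
          have hM : ((M k : ℝ) + 1) * S.a k ≤ 3 := by
            have h1 : (M k : ℝ) < 1 / S.a k + 1 := Nat.ceil_lt_add_one (by positivity)
            have h2 : (M k : ℝ) * S.a k < 1 + S.a k := by
              have := mul_lt_mul_of_pos_right h1 ha
              rwa [add_mul, one_div, inv_mul_cancel₀ ha.ne', one_mul] at this
            nlinarith
          rw [Real.rpow_add ha, Real.rpow_natCast]
          have e : 2 ^ k * ((M k : ℝ) + 1) ^ N * (S.a k ^ (q : ℝ) * S.a k ^ N) =
            (((M k : ℝ) + 1) * S.a k) ^ N * (2 ^ k * S.a k ^ (q : ℝ)) := by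
            rw [mul_pow]; ring
          rw [e]
          refine mul_le_mul_of_nonneg_right ?_ (by positivity)
          exact pow_le_pow_left₀ (by positivity) hM N
  refine (liminf_le_liminf hup).trans ?_
  have h3 : Tendsto (fun k => ENNReal.ofReal (3 ^ N * (2 ^ k * S.a k ^ (q : ℝ)))) atTop (𝓝 0) := by
    have := ENNReal.tendsto_ofReal (h.const_mul ((3:ℝ) ^ N))
    simpa using this
  rw [h3.liminf_eq]

theorem box_dimH_le (S : CScale) (N : ℕ) (r : ℝ≥0∞) (h : S.Adm r) :
    dimH (univ : Set (Box S N)) ≤ r + N := by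
  refine le_of_forall_gt fun c hc => ?_
  obtain ⟨e, he1, he2⟩ := ENNReal.lt_iff_exists_nnreal_btwn.1 hc
  refine lt_of_le_of_lt ?_ he2
  have hN : (N : ℝ≥0) ≤ e := by
    have : ((N : ℝ≥0) : ℝ≥0∞) < e := lt_of_le_of_lt (by simp) he1
    exact_mod_cast this.le
  have hq : r < ((e - N : ℝ≥0) : ℝ≥0∞) := by
    rw [ENNReal.coe_sub]
    exact lt_tsub_iff_right.2 (by simpa using he1)
  have := box_hausdorff_zero S N (e - N) (h.upper _ hq)
  refine dimH_le_of_hausdorffMeasure_ne_top ?_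
  rw [NNReal.coe_sub hN] at this
  simp only [NNReal.coe_natCast, sub_add_cancel] at this
  rw [this]; simp

theorem box_measure_le (S : CScale) (N : ℕ) (z : Box S N) (δ : ℝ) (hδ : 0 < δ) (q : ℝ≥0) (k₀ : ℕ)
    (hk₀ : ∀ k ≥ k₀, (2⁻¹ : ℝ) ^ k ≤ S.a k ^ (q : ℝ)) (hd : δ < S.a k₀) :
    (cantMeas S).prod volume (Metric.closedBall z δ) ≤
      2 ^ N * ENNReal.ofReal δ ^ ((q : ℝ) + N) := by
  classical
  obtain ⟨c, x⟩ := z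
  rw [← closedBall_prod_same, Measure.prod_prod]
  have hex : ∃ k, S.a k ≤ δ := ((S.lim.eventually (gt_mem_nhds hδ)).exists).imp fun _ h => h.le
  have hk1 := Nat.find_spec hex
  have hk2 : ∀ j < Nat.find hex, δ < S.a j := fun j hj => not_le.1 (Nat.find_min hex hj)
  set k := Nat.find hex with hk
  have hk3 : k₀ ≤ k := by
    by_contra hc
    exact absurd (S.anti (not_le.1 hc).le) (not_le.2 (hk1.trans_lt hd))
  have h1 : cantMeas S (Metric.closedBall c δ) ≤ ENNReal.ofReal δ ^ (q : ℝ) := by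
    refine (cantMeas_closedBall_le S c k δ hk2).trans ?_
    have : (2⁻¹ : ℝ≥0∞) ^ k = ENNReal.ofReal ((2⁻¹ : ℝ) ^ k) := by
      rw [ENNReal.ofReal_pow (by norm_num), ENNReal.ofReal_inv_of_pos (by norm_num)]; simp
    rw [this, ENNReal.ofReal_rpow_of_pos hδ]
    refine ENNReal.ofReal_le_ofReal ((hk₀ k hk3).trans ?_)
    exact Real.rpow_le_rpow (S.pos k).le hk1 q.2
  have h2 : volume (Metric.closedBall x δ) ≤ 2 ^ N * ENNReal.ofReal δ ^ N := by
    rw [volume_pi_closedBall x hδ.le]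
    refine (Finset.prod_le_prod' fun i _ => volume_unitInterval_closedBall_le (x i) δ).trans ?_
    rw [Finset.prod_const, Finset.card_univ, Fintype.card_fin, ENNReal.ofReal_mul (by norm_num),
      mul_pow]
    simp
  calc _ ≤ ENNReal.ofReal δ ^ (q : ℝ) * (2 ^ N * ENNReal.ofReal δ ^ N) := mul_le_mul' h1 h2
    _ = _ := by
      rw [ENNReal.rpow_add _ _ (by simpa using hδ) (by simp), ENNReal.rpow_natCast]
      ring

theorem box_dimH_ge (S : CScale) (N : ℕ) (r : ℝ≥0∞) (h : S.Adm r) (W : Set (Box S N))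
    (hW : IsOpen W) (hne : W.Nonempty) : r + N ≤ dimH W := by
  have key : ∀ q : ℝ≥0, (q : ℝ≥0∞) ≤ r → (q : ℝ≥0∞) + N ≤ dimH W := by
    intro q hq
    obtain ⟨k₀, hk₀⟩ := eventually_atTop.1 (h.lower q hq)
    have hle : ((2 : ℝ≥0∞) ^ N)⁻¹ • (cantMeas S).prod volume ≤ (μH[(q : ℝ) + N] : Measure (Box S N)) := by
      refine Measure.le_hausdorffMeasure _ _ (ENNReal.ofReal (S.a k₀ / 2))
        (by simpa using S.pos k₀) fun A hA => ?_
      rcases A.eq_empty_or_nonempty with rfl | ⟨z, hz⟩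
      · simp
      have hDt : Metric.ediam A ≠ ⊤ := ne_top_of_le_ne_top ENNReal.ofReal_ne_top hA
      set D := (Metric.ediam A).toReal with hD
      have hD0 : Metric.ediam A = ENNReal.ofReal D := (ENNReal.ofReal_toReal hDt).symm
      have hDlt : D < S.a k₀ := by
        have : D ≤ S.a k₀ / 2 := ENNReal.toReal_le_of_le_ofReal (by linarith [S.pos k₀]) hA
        linarith [S.pos k₀]
      have hmain : ∀ᶠ δ in 𝓝[>] D, (cantMeas S).prod volume A ≤
          2 ^ N * ENNReal.ofReal δ ^ ((q : ℝ) + N) := by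
        filter_upwards [Ioo_mem_nhdsGT hDlt] with δ hδ
        have hδ0 : 0 < δ := lt_of_le_of_lt ENNReal.toReal_nonneg hδ.1
        refine (measure_mono ?_).trans (box_measure_le S N z δ hδ0 q k₀ hk₀ hδ.2)
        intro w hw
        rw [Metric.mem_closedBall, ← ENNReal.ofReal_le_ofReal_iff hδ0.le, ← edist_dist]
        refine (Metric.edist_le_ediam_of_mem hw hz).trans ?_
        rw [hD0]
        exact ENNReal.ofReal_le_ofReal hδ.1.le
      have hcont : Tendsto (fun δ => 2 ^ N * ENNReal.ofReal δ ^ ((q : ℝ) + N)) (𝓝[>] D)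
          (𝓝 (2 ^ N * ENNReal.ofReal D ^ ((q : ℝ) + N))) := by
        refine ENNReal.Tendsto.const_mul ?_ (Or.inr (by simp))
        exact ((ENNReal.continuous_rpow_const.comp ENNReal.continuous_ofReal).tendsto D).mono_left
          nhdsWithin_le_nhds
      have := ge_of_tendsto hcont hmain
      rw [Measure.smul_apply, smul_eq_mul, hD0]
      calc _ ≤ ((2 : ℝ≥0∞) ^ N)⁻¹ * (2 ^ N * ENNReal.ofReal D ^ ((q : ℝ) + N)) := by gcongr
        _ = _ := by
          rw [← mul_assoc, ENNReal.inv_mul_cancel (by simp) (by simp), one_mul]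
    have : IsOpenPosMeasure (volume : Measure (Fin N → unitInterval)) :=
      Measure.pi.isOpenPosMeasure _
    have hpos : 0 < (cantMeas S).prod (volume : Measure (Fin N → unitInterval)) W :=
      hW.measure_pos _ hne
    have h2 := hle W
    have h3 : (μH[(q : ℝ) + N] : Measure (Box S N)) W ≠ 0 := by
      refine (lt_of_lt_of_le ?_ h2).ne'
      rw [Measure.smul_apply, smul_eq_mul]
      exact ENNReal.mul_pos (by simp) hpos.ne'
    have := le_dimH_of_hausdorffMeasure_ne_zero (d := q + N) (s := W) (by simpa using h3)
    simpa using this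
  rcases eq_or_ne r ⊤ with rfl | hr
  · rw [_root_.top_add]
    refine ENNReal.le_of_forall_nnreal_lt fun e _ => ?_
    exact le_self_add.trans (key e le_top)
  · lift r to ℝ≥0 using hr
    exact key r le_rfl

theorem box_dimH (S : CScale) (N : ℕ) (r : ℝ≥0∞) (h : S.Adm r) :
    dimH (univ : Set (Box S N)) = r + N :=
  le_antisymm (box_dimH_le S N r h) (box_dimH_ge S N r h _ isOpen_univ univ_nonempty)

theorem box_indLe (S : CScale) (N : ℕ) : indLe N (Box S N) := by
  obtain ⟨S₀, h₀⟩ := exists_scale 0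
  have h1 : indLe N (Box S₀ N) := by
    have := box_hausdorff_zero S₀ N 1 (h₀.upper 1 (by simp))
    refine indLe_of_hausdorff_zero N _ ?_
    rw [add_comm]
    simpa using this
  let e : Box S N ≃ₜ Box S₀ N :=
    ((homeoCant S).symm.trans (homeoCant S₀)).prodCongr (Homeomorph.refl _)
  exact indLe_of_isInducing N _ _ e e.isInducing h1

theorem box_not_indLe (S : CScale) (m : ℕ) : ¬ indLe m (Box S (m + 1)) := by
  intro h
  refine not_indLe_cube m ?_
  exact indLe_of_isInducing m _ _ (fun x => ((Classical.arbitrary (Cant S), x) : Box S (m + 1)))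
    (isEmbedding_prodMkRight _).isInducing h

theorem box_dimTH_ge (S : CScale) (m : ℕ) (r : ℝ≥0∞) (h : S.Adm r) :
    r + (m + 1 : ℕ) ≤ dimTH (Box S (m + 1)) := by
  refine le_iInf₂ ?_
  rintro c ⟨B, hB, hc⟩
  let z₀ : Box S (m + 1) := (Classical.arbitrary _, fun _ => 0)
  let O : Set (Box S (m + 1)) := {z | (z.2 0 : ℝ) < 1 / 2}
  have hO : IsOpen O := isOpen_lt (by fun_prop) continuous_const
  obtain ⟨U, hU, hz, hUO⟩ := hB.exists_subset_of_mem_open (show z₀ ∈ O by simp [O, z₀]) hO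
  have hUo := hB.isOpen hU
  let ι : Box S m → unitInterval → Box S (m + 1) := fun w τ => (w.1, Fin.cons τ w.2)
  have hι : Continuous fun p : Box S m × unitInterval => ι p.1 p.2 := by
    refine (continuous_fst.fst).prodMk ?_
    exact Continuous.finCons continuous_snd continuous_fst.snd
  let W : Set (Box S m) := {w | ι w 0 ∈ U}
  have hW : IsOpen W := hUo.preimage (hι.comp (continuous_id.prodMk continuous_const))
  have hWne : W.Nonempty := by
    refine ⟨(z₀.1, fun _ => 0), ?_⟩
    have : ι (z₀.1, fun _ => 0) 0 = z₀ := by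
      refine Prod.ext rfl ?_
      funext i
      refine Fin.cases rfl (fun j => rfl) i
    show ι _ 0 ∈ U
    rwa [this]
  let π : Box S (m + 1) → Box S m := fun z => (z.1, fun j => z.2 j.succ)
  have hπ : LipschitzWith 1 π := by
    refine LipschitzWith.of_dist_le_mul fun x y => ?_
    rw [NNReal.coe_one, one_mul, Prod.dist_eq, Prod.dist_eq]
    refine max_le_max le_rfl ?_
    refine (dist_pi_le_iff dist_nonneg).2 fun j => ?_
    exact dist_le_pi_dist x.2 y.2 j.succ
  have hsub : W ⊆ π '' frontier U := by
    intro w hw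
    by_contra hcon
    have hno : ∀ τ, ι w τ ∉ frontier U := fun τ hτ => hcon ⟨_, hτ, rfl⟩
    have hcl : IsClopen {τ | ι w τ ∈ U} := by
      have hcw : Continuous (ι w) := hι.comp (continuous_const.prodMk continuous_id)
      refine ⟨?_, hUo.preimage hcw⟩
      have : {τ | ι w τ ∈ U} = (ι w) ⁻¹' closure U := by
        ext τ
        refine ⟨fun h => subset_closure h, fun h => ?_⟩
        by_contra h2
        refine hno τ ⟨h, ?_⟩
        rwa [hUo.interior_eq]
      rw [this]
      exact isClosed_closure.preimage hcw
    have huniv := hcl.eq_univ ⟨0, hw⟩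
    have h1 : ι w 1 ∈ U := by
      have : (1 : unitInterval) ∈ {τ | ι w τ ∈ U} := by rw [huniv]; trivial
      exact this
    have h2 : ((1 : unitInterval) : ℝ) < 1 / 2 := hUO h1
    norm_num at h2
  have hdim : r + m ≤ dimH (frontier U) :=
    (box_dimH_ge S m r h W hW hWne).trans ((dimH_mono hsub).trans (hπ.dimH_image_le _))
  rcases hc U hU with h0 | h0
  · obtain ⟨w, hw⟩ := hWne
    obtain ⟨z, hz, _⟩ := hsub hw
    rw [h0] at hz
    exact absurd hz (notMem_empty _)
  · refine le_trans ?_ h0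
    push_cast
    rw [← add_assoc]
    gcongr

theorem box_dimTH (S : CScale) (m : ℕ) (r : ℝ≥0∞) (h : S.Adm r) :
    dimTH (Box S (m + 1)) = r + (m + 1 : ℕ) := by
  refine le_antisymm ?_ (box_dimTH_ge S m r h)
  have := box_dimH S (m + 1) r h
  rw [← this]
  refine dimTH_le_dimH ?_
  rw [this]
  push_cast
  exact le_add_self.trans le_add_self


/-! ### Disjoint unions and assembly -/

theorem frontier_inl_subset {X Y : Type} [TopologicalSpace X] [TopologicalSpace Y] {U : Set X}
    (hU : IsOpen U) : frontier (Sum.inl '' U : Set (X ⊕ Y)) ⊆ Sum.inl '' frontier U := by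
  rintro z ⟨h1, h2⟩
  rw [IsClosedEmbedding.inl.closure_image_eq] at h1
  obtain ⟨y, hy, rfl⟩ := h1
  refine ⟨y, ⟨hy, fun h => h2 ?_⟩, rfl⟩
  rw [(isOpenMap_inl U hU).interior_eq]
  exact ⟨y, interior_subset h, rfl⟩

theorem frontier_inr_subset {X Y : Type} [TopologicalSpace X] [TopologicalSpace Y] {U : Set Y}
    (hU : IsOpen U) : frontier (Sum.inr '' U : Set (X ⊕ Y)) ⊆ Sum.inr '' frontier U := by
  rintro z ⟨h1, h2⟩
  rw [IsClosedEmbedding.inr.closure_image_eq] at h1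
  obtain ⟨y, hy, rfl⟩ := h1
  refine ⟨y, ⟨hy, fun h => h2 ?_⟩, rfl⟩
  rw [(isOpenMap_inr U hU).interior_eq]
  exact ⟨y, interior_subset h, rfl⟩

theorem indLe_sum (n : ℕ) (X Y : Type) [TopologicalSpace X] [TopologicalSpace Y]
    (hX : indLe (n + 1) X) (hY : indLe 0 Y) : indLe (n + 1) (X ⊕ Y) := by
  obtain ⟨B, hB, h⟩ := hX
  obtain ⟨C, hC, h'⟩ := hY
  refine ⟨_, hB.sum hC, ?_⟩
  rintro _ (⟨U, hU, rfl⟩ | ⟨U, hU, rfl⟩)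
  · have e := (IsEmbedding.inl (X := X) (Y := Y)).homeomorphImage (frontier U)
    have h1 : indLe n ↥(Sum.inl '' frontier U : Set (X ⊕ Y)) :=
      indLe_of_isInducing n _ _ e.symm e.symm.isInducing (h U hU)
    exact indLe_of_isInducing n _ _ _
      (IsEmbedding.inclusion (frontier_inl_subset (hB.isOpen hU))).isInducing h1
  · have : IsEmpty ↥(frontier (Sum.inr '' U : Set (X ⊕ Y))) := by
      have := frontier_inr_subset (X := X) (hC.isOpen hU)
      rw [h' U hU, image_empty, subset_empty_iff] at this
      rw [this]; infer_instance
    exact indLe_of_isEmpty n _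

theorem dimTH_mono_isometry {X Y : Type} [MetricSpace X] [MetricSpace Y] {f : X → Y}
    (hf : Isometry f) : dimTH X ≤ dimTH Y := by
  refine le_iInf₂ ?_
  rintro c ⟨B, hB, h⟩
  refine dimTH_le_s16 _ (isTopologicalBasis_preimage hf.isEmbedding.isInducing hB) ?_
  rintro _ ⟨U, hU, rfl⟩
  have hs := frontier_preimage_subset' hf.continuous U
  rcases h U hU with h0 | h0
  · left
    rwa [h0, preimage_empty, subset_empty_iff] at hs
  · right
    refine le_trans ?_ h0
    gcongr
    rw [← hf.dimH_image]
    exact dimH_mono (image_subset_iff.2 hs)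

section
attribute [local instance] Metric.metricSpaceSum

theorem dimTH_sum_le (X Y : Type) [MetricSpace X] [MetricSpace Y] (hY : indLe 0 Y) :
    dimTH (X ⊕ Y) ≤ dimTH X := by
  refine le_iInf₂ ?_
  rintro c ⟨B, hB, h⟩
  obtain ⟨C, hC, h'⟩ := hY
  refine dimTH_le_s16 _ (hB.sum hC) ?_
  rintro _ (⟨U, hU, rfl⟩ | ⟨U, hU, rfl⟩)
  · have hs := frontier_inl_subset (Y := Y) (hB.isOpen hU)
    rcases h U hU with h0 | h0
    · left
      rwa [h0, image_empty, subset_empty_iff] at hs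
    · right
      refine le_trans ?_ h0
      gcongr
      rw [← (Metric.isometry_inl (X := X) (Y := Y)).dimH_image]
      exact dimH_mono hs
  · left
    have hs := frontier_inr_subset (X := X) (hC.isOpen hU)
    rwa [h' U hU, image_empty, subset_empty_iff] at hs

theorem dimH_sum (X Y : Type) [MetricSpace X] [MetricSpace Y] :
    dimH (univ : Set (X ⊕ Y)) = max (dimH (univ : Set X)) (dimH (univ : Set Y)) := by
  rw [← (Metric.isometry_inl (X := X) (Y := Y)).dimH_image univ,
    ← (Metric.isometry_inr (X := X) (Y := Y)).dimH_image univ, ← dimH_union]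
  congr 1
  ext z
  cases z <;> simp

theorem realize_finite (m : ℕ) (s t : ℝ≥0∞) (h1 : ((m + 1 : ℕ) : ℝ≥0∞) ≤ s) (h2 : s ≤ t) :
    ∃ (K : Type) (_ : MetricSpace K), CompactSpace K ∧ Nonempty K ∧
      dimt K = ((m + 1 : ℕ) : ℕ∞) ∧ dimTH K = s ∧ dimH (Set.univ : Set K) = t := by
  obtain ⟨S, hS⟩ := exists_scale (s - (m + 1 : ℕ))
  obtain ⟨T, hT⟩ := exists_scale t
  have hr : s - (m + 1 : ℕ) + (m + 1 : ℕ) = s := tsub_add_cancel_of_le h1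
  have hT0 : indLe 0 (Box T 0) := box_indLe T 0
  have hd : dimTH (Box S (m + 1)) = s := by rw [box_dimTH S m _ hS, hr]
  refine ⟨Box S (m + 1) ⊕ Box T 0, inferInstance, inferInstance, inferInstance, ?_, ?_, ?_⟩
  · refine le_antisymm (dimt_le (indLe_sum m _ _ (box_indLe S (m + 1)) hT0)) ?_
    by_contra hc
    have hc' : dimt (Box S (m + 1) ⊕ Box T 0) ≤ (m : ℕ∞) := by
      rw [not_le] at hc
      push_cast at hc
      exact Order.le_of_lt_add_one hc
    exact box_not_indLe S m (indLe_of_isInducing m _ _ Sum.inl IsEmbedding.inl.isInducing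
      (indLe_of_dimt_le hc'))
  · refine le_antisymm ((dimTH_sum_le _ _ hT0).trans hd.le) ?_
    rw [← hd]
    exact dimTH_mono_isometry Metric.isometry_inl
  · rw [dimH_sum, box_dimH S _ _ hS, box_dimH T _ _ hT, hr]
    simpa using h2

end

theorem realize_zero (t : ℝ≥0∞) :
    ∃ (K : Type) (_ : MetricSpace K), CompactSpace K ∧ Nonempty K ∧
      dimt K = 0 ∧ dimTH K = 0 ∧ dimH (Set.univ : Set K) = t := by
  obtain ⟨T, hT⟩ := exists_scale t
  have hT0 : indLe 0 (Box T 0) := box_indLe T 0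
  refine ⟨Box T 0, inferInstance, inferInstance, inferInstance, ?_, dimTH_eq_zero hT0, ?_⟩
  · exact le_antisymm (dimt_le hT0) (zero_le)
  · simpa using box_dimH T 0 t hT

theorem hilbert_not_indLe (n : ℕ) : ¬ indLe n (ℕ → unitInterval) := by
  intro h
  refine not_indLe_cube n ?_
  let f : (Fin (n + 1) → unitInterval) → (ℕ → unitInterval) := fun x i =>
    if h : i < n + 1 then x ⟨i, h⟩ else 0
  let g : (ℕ → unitInterval) → (Fin (n + 1) → unitInterval) := fun y i => y i
  have hf : Continuous f := by
    refine continuous_pi fun i => ?_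
    by_cases hi : i < n + 1
    · simp only [f, dif_pos hi]
      exact continuous_apply _
    · simp only [f, dif_neg hi]
      exact continuous_const
  have hg : Continuous g := continuous_pi fun i => continuous_apply _
  have hfg : Function.LeftInverse g f := by
    intro x; funext i
    simp only [f, g, dif_pos i.2]
  exact indLe_of_isInducing n _ _ f (hfg.isEmbedding hg hf).isInducing h

theorem realize_top :
    ∃ (K : Type) (_ : MetricSpace K), CompactSpace K ∧ Nonempty K ∧
      dimt K = ⊤ ∧ dimTH K = ⊤ ∧ dimH (Set.univ : Set K) = ⊤ := by
  have hdt : dimt (ℕ → unitInterval) = ⊤ := by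
    unfold dimt
    simp [hilbert_not_indLe]
  have hcs : CompactSpace (ℕ → unitInterval) := inferInstance
  let M : MetricSpace (ℕ → unitInterval) := metrizableSpaceMetric (ℕ → unitInterval)
  refine ⟨ℕ → unitInterval, M, hcs, inferInstance, hdt, ?_⟩
  have h := @triple_restrictions (ℕ → unitInterval) M
  have hdt' : @dimt (ℕ → unitInterval) M.toUniformSpace.toTopologicalSpace = ⊤ := hdt
  rw [hdt'] at h
  rcases h with ⟨h, _⟩ | ⟨_, _, _, h1, h2⟩
  · exact absurd h (by simp)
  · have h3 := top_le_iff.1 (le_trans (by simp) h1)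
    refine ⟨h3, ?_⟩
    rw [h3] at h2
    exact top_le_iff.1 h2

theorem realize (d : ℕ∞) (s t : ℝ≥0∞) (h : (d = 0 ∧ s = 0) ∨
        (1 ≤ d ∧ 1 ≤ s ∧ 1 ≤ t ∧ (d : ℝ≥0∞) ≤ s ∧ s ≤ t)) :
    ∃ (K : Type) (_ : MetricSpace K), CompactSpace K ∧ Nonempty K ∧
        dimt K = d ∧ dimTH K = s ∧ dimH (Set.univ : Set K) = t := by
  rcases h with ⟨rfl, rfl⟩ | ⟨h1, _, _, h2, h3⟩
  · exact realize_zero t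
  · rcases eq_or_ne d ⊤ with rfl | hd
    · have hs : s = ⊤ := by simpa using h2
      subst hs
      have ht : t = ⊤ := by simpa using h3
      subst ht
      exact realize_top
    · lift d to ℕ using hd
      obtain ⟨m, rfl⟩ : ∃ m, d = m + 1 := by
        have : 1 ≤ d := by exact_mod_cast h1
        exact ⟨d - 1, by omega⟩
      exact realize_finite m s t (by simpa using h2) h3

end Helpers

/-- The possible values of the triple `(dim_t K, dim_tH K, dim_H K)` for nonempty
compact (equivalently separable, equivalently arbitrary) metric spaces: besides the
trivial cases of the empty space (`(-1,-1,-1)`) and zero-dimensional spaces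
(`d = s = 0`, `t` arbitrary), they are exactly the triples with `d ∈ ℕ⁺ ∪ {∞}`,
`s, t ∈ [1,∞]`, `d ≤ s ≤ t`. -/
theorem stmt16 (d : ℕ∞) (s t : ℝ≥0∞) :
    List.TFAE [
      ∃ (K : Type) (_ : MetricSpace K), CompactSpace K ∧ Nonempty K ∧
        dimt K = d ∧ dimTH K = s ∧ dimH (Set.univ : Set K) = t,
      ∃ (X : Type) (_ : MetricSpace X), SeparableSpace X ∧ Nonempty X ∧
        dimt X = d ∧ dimTH X = s ∧ dimH (Set.univ : Set X) = t,
      ∃ (X : Type) (_ : MetricSpace X), Nonempty X ∧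
        dimt X = d ∧ dimTH X = s ∧ dimH (Set.univ : Set X) = t,
      (d = 0 ∧ s = 0) ∨
        (1 ≤ d ∧ 1 ≤ s ∧ 1 ≤ t ∧ (d : ℝ≥0∞) ≤ s ∧ s ≤ t)] := by
  tfae_have 1 → 2 := by
    rintro ⟨K, hK, hc, hn, h⟩
    exact ⟨K, hK, inferInstance, hn, h⟩
  tfae_have 2 → 3 := by
    rintro ⟨X, hX, _, hn, h⟩
    exact ⟨X, hX, hn, h⟩
  tfae_have 3 → 4 := by
    rintro ⟨X, hX, hn, rfl, rfl, rfl⟩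
    exact triple_restrictions
  tfae_have 4 → 1 := realize d s t
  tfae_finish
end
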